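/- arXiv:2406.11221 — 9 statements merged into one kernel-verified Lean document; each statement's English description precedes it below -/
import Mathlib

section
/- Let X be a compact Hausdorff space and M a unital Banach C(X,ℂ)-module that is C(X)-convex and has continuous fiber norms (equivalently, M is the section module Γ(E) of a continuous (F) Banach bundle E over X). If M is finitely generated as a C(X,ℂ)-module in the algebraic sense, then M is a finitely generated projective C(X,ℂ)-module. -/
/-- The ideal of continuous functions vanishing on the subset `Y`. -/
noncomputable def IY {X : Type*} [TopologicalSpace X] (Y : Set X) : Ideal C(X, ℂ) where
  carrier := {f : C(X, ℂ) | ∀ y ∈ Y, f y = 0}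
  add_mem' := by
    intro a b ha hb y hy
    simp [ha y hy, hb y hy]
  zero_mem' := by
    intro y hy
    simp
  smul_mem' := by
    intro c f hf y hy
    simp [hf y hy]

/-- A real-valued continuous function regarded as a complex-valued one. -/
noncomputable def ofRealCM {X : Type*} [TopologicalSpace X] (f : C(X, ℝ)) : C(X, ℂ) :=
  ⟨fun x => (f x : ℂ), Complex.continuous_ofReal.comp f.continuous⟩

/-- A finite module is projective as soon as, away from each maximal ideal, multiplication by some
scalar factors through a finite free module. -/
theorem projective_of_local_factorization {R M : Type*} [CommRing R] [AddCommGroup M] [Module R M]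
    [Module.Finite R M]
    (h : ∀ I : Ideal R, I.IsMaximal → ∃ r ∉ I, ∃ k : ℕ,
      ∃ (q : (Fin k → R) →ₗ[R] M) (σ : M →ₗ[R] (Fin k → R)), ∀ m, q (σ m) = r • m) :
    Module.Projective R M := by
  obtain ⟨n, p, hp⟩ := Module.Finite.exists_fin' R M
  let J : Ideal R :=
    { carrier := {r | ∃ σ : M →ₗ[R] (Fin n → R), ∀ m, p (σ m) = r • m}
      add_mem' := by
        rintro a b ⟨σ, hσ⟩ ⟨τ, hτ⟩
        exact ⟨σ + τ, fun m => by simp [hσ, hτ, add_smul]⟩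
      zero_mem' := ⟨0, fun m => by simp⟩
      smul_mem' := by
        rintro c a ⟨σ, hσ⟩
        exact ⟨c • σ, fun m => by simp [hσ, mul_smul]⟩ }
  have hJ : J = ⊤ := by
    by_contra hne
    obtain ⟨I, hI, hJI⟩ := J.exists_le_maximal hne
    obtain ⟨r, hr, k, q, σ, hσ⟩ := h I hI
    obtain ⟨l, hl⟩ := Module.projective_lifting_property p q hp
    refine hr (hJI ⟨l ∘ₗ σ, fun m => ?_⟩)
    rw [← hσ m, ← hl]
    rfl
  obtain ⟨σ, hσ⟩ : (1 : R) ∈ J := hJ ▸ Submodule.mem_top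
  exact Module.Projective.of_split σ p (LinearMap.ext fun m => by simp [hσ])

/-- If `w` annihilates the kernel of `q` and `u` maps the target of `q` into its range, then
multiplication by `w * u` factors through `q`. -/
theorem exists_factorization_of_smul {R M P : Type*} [CommRing R] [AddCommGroup M] [Module R M]
    [AddCommGroup P] [Module R P] (q : P →ₗ[R] M) (w u : R)
    (hw : ∀ g, q g = 0 → w • g = 0) (hu : ∀ m, ∃ g, q g = u • m) :
    ∃ σ : M →ₗ[R] P, ∀ m, q (σ m) = (w * u) • m := by
  choose g hg using hu
  refine ⟨{ toFun := fun m => w • g m, map_add' := fun a b => ?_, map_smul' := fun c a => ?_ },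
    fun m => by simp [hg, mul_smul]⟩
  · have := hw (g (a + b) - (g a + g b)) (by simp [hg])
    rwa [smul_sub, sub_eq_zero, smul_add] at this
  · have := hw (g (c • a) - c • g a) (by simp [hg, smul_comm u c a])
    rw [smul_sub, sub_eq_zero] at this
    simpa [smul_comm w c] using this

/-- Elements with coefficients in an ideal, in terms of a finite spanning family. -/
theorem exists_linearCombination_of_mem_ideal_smul_top {R M ι : Type*} [CommRing R]
    [AddCommGroup M] [Module R M] [Fintype ι] {s : ι → M}
    (hs : Submodule.span R (Set.range s) = ⊤) {I : Ideal R} {m : M}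
    (hm : m ∈ I • (⊤ : Submodule R M)) :
    ∃ f : ι → R, (∀ i, f i ∈ I) ∧ Fintype.linearCombination R s f = m := by
  rw [← hs, Submodule.mem_ideal_smul_span_iff_exists_sum] at hm
  obtain ⟨a, ha, hm⟩ := hm
  refine ⟨a, ha, ?_⟩
  rw [← hm, Finsupp.sum_fintype _ _ (by simp), Fintype.linearCombination_apply]

theorem mem_IY_singleton {X : Type*} [TopologicalSpace X] {x : X} {f : C(X, ℂ)} :
    f ∈ IY {x} ↔ f x = 0 := by
  change (∀ y ∈ ({x} : Set X), f y = 0) ↔ _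
  simp

section

variable {X M : Type*} [TopologicalSpace X] [CompactSpace X]
  [NormedAddCommGroup M] [Module C(X, ℂ) M]

/-- The norm of the value of `m` in the fiber at `x`. -/
noncomputable def fiberNorm (m : M) (x : X) : ℝ :=
  Metric.infDist m ((IY {x} • (⊤ : Submodule C(X, ℂ) M) : Submodule C(X, ℂ) M) : Set M)

/-- If all fiber norms are continuous, then the fiber norm is jointly continuous. -/
theorem continuous_fiberNorm
    (hfib : ∀ m : M, Continuous fun x : X =>
      Metric.infDist m ((IY {x} • (⊤ : Submodule C(X, ℂ) M) : Submodule C(X, ℂ) M) : Set M)) :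
    Continuous fun z : M × X => fiberNorm z.1 z.2 :=
  continuous_prod_of_continuous_lipschitzWith (fun z : M × X => fiberNorm z.1 z.2) 1 hfib
    fun y => Metric.lipschitz_infDist_pt
      ((IY {y} • (⊤ : Submodule C(X, ℂ) M) : Submodule C(X, ℂ) M) : Set M)

variable [NormedSpace ℂ M] [IsScalarTower ℂ C(X, ℂ) M]

/-- Linear combinations of a finite family are bounded for the supremum norm. -/
noncomputable def linearCombinationCLM {ι : Type*} [Fintype ι]
    (hnorm : ∀ (f : C(X, ℂ)) (m : M), ‖f • m‖ ≤ ‖f‖ * ‖m‖) (s : ι → M) :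
    (ι → C(X, ℂ)) →L[ℂ] M :=
  LinearMap.mkContinuous ((Fintype.linearCombination C(X, ℂ) s).restrictScalars ℂ)
    (∑ i, ‖s i‖) fun f => by
      rw [LinearMap.restrictScalars_apply, Fintype.linearCombination_apply, Finset.sum_mul]
      refine norm_sum_le_of_le _ fun i _ => (hnorm _ _).trans ?_
      rw [mul_comm]
      gcongr
      exact norm_le_pi_norm f i

/-- If a family `v` spans the fiber at `x` (modulo closure), then some function which does not
vanish at `x` multiplies `M` into the span of `v`. -/
theorem exists_smul_mem_of_mem_closure [CompleteSpace M]
    (hnorm : ∀ (f : C(X, ℂ)) (m : M), ‖f • m‖ ≤ ‖f‖ * ‖m‖) {n : ℕ} {s : Fin n → M}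
    (hs : Submodule.span C(X, ℂ) (Set.range s) = ⊤) (x : X) (N : Submodule C(X, ℂ) M)
    (hN : ∀ j, ∃ t ∈ N, s j - t ∈
      closure ((IY {x} • (⊤ : Submodule C(X, ℂ) M) : Submodule C(X, ℂ) M) : Set M)) :
    ∃ u : C(X, ℂ), u x ≠ 0 ∧ ∀ m : M, u • m ∈ N := by
  have hsurj : Function.Surjective (linearCombinationCLM hnorm s) := fun m => by
    have hm : m ∈ Submodule.span C(X, ℂ) (Set.range s) := hs ▸ Submodule.mem_top
    obtain ⟨c, hc⟩ := (Submodule.mem_span_range_iff_exists_fun _).1 hm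
    exact ⟨c, hc⟩
  obtain ⟨K, hK, hpre⟩ := (linearCombinationCLM hnorm s).exists_preimage_norm_le hsurj
  have key : ∀ j, ∃ (a b : Fin n → C(X, ℂ)), (∀ k, ‖a k‖ < 1 / (n + 1)) ∧ (∀ k, b k x = 0) ∧
      s j - Fintype.linearCombination C(X, ℂ) s a - Fintype.linearCombination C(X, ℂ) s b ∈ N := by
    intro j
    obtain ⟨t, ht, hcl⟩ := hN j
    obtain ⟨z, hz, hdist⟩ := Metric.mem_closure_iff.1 hcl (1 / (n + 1) / K) (by positivity)
    obtain ⟨b, hb, rfl⟩ := exists_linearCombination_of_mem_ideal_smul_top hs hz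
    obtain ⟨a, ha, hle⟩ := hpre (s j - t - Fintype.linearCombination C(X, ℂ) s b)
    replace ha : Fintype.linearCombination C(X, ℂ) s a = _ := ha
    refine ⟨a, b, fun k => (norm_le_pi_norm a k).trans_lt (hle.trans_lt ?_),
      fun k => mem_IY_singleton.1 (hb k), ?_⟩
    · rw [dist_eq_norm, lt_div_iff₀ hK] at hdist
      rwa [mul_comm]
    · rw [ha]
      convert ht using 1
      abel
  choose a b ha hb hmem using key
  let D : Matrix (Fin n) (Fin n) C(X, ℂ) := 1 - Matrix.of a - Matrix.of b
  have hD : ∀ j, ∑ k, D j k • s k ∈ N := by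
    intro j
    convert hmem j using 1
    simp [D, sub_smul, Finset.sum_sub_distrib, Fintype.linearCombination_apply, Matrix.one_apply,
      ite_smul]
  refine ⟨D.det, ?_, fun m => ?_⟩
  · let ev : C(X, ℂ) →+* ℂ := (Pi.evalRingHom _ x).comp ContinuousMap.coeFnRingHom
    change ev D.det ≠ 0
    rw [RingHom.map_det]
    refine det_ne_zero_of_sum_row_lt_diag fun k => ?_
    have hent : ∀ i j, ev.mapMatrix D i j = (1 : Matrix (Fin n) (Fin n) ℂ) i j - a i j x := by
      intro i j
      change (D i j) x = _
      by_cases hij : i = j <;> simp [D, hb, Matrix.one_apply, hij]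
    have hax : ∀ i j, ‖a i j x‖ < 1 / (n + 1) := fun i j =>
      ((a i j).norm_coe_le_norm x).trans_lt (ha i j)
    have hη : (0 : ℝ) < 1 / (n + 1) := by positivity
    have hn : 1 ≤ n := Nat.one_le_of_lt k.isLt
    calc ∑ j ∈ Finset.univ.erase k, ‖ev.mapMatrix D k j‖
        ≤ ∑ j ∈ Finset.univ.erase k, (1 / (n + 1) : ℝ) := by
          refine Finset.sum_le_sum fun j hj => ?_
          rw [hent, Matrix.one_apply_ne (Finset.ne_of_mem_erase hj).symm, zero_sub, norm_neg]
          exact (hax k j).le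
      _ = 1 - 2 * (1 / (n + 1)) := by
          rw [Finset.sum_const, Finset.card_erase_of_mem (Finset.mem_univ k), Finset.card_univ,
            Fintype.card_fin, nsmul_eq_mul, Nat.cast_sub hn]
          field_simp
          push_cast
          ring
      _ < 1 - ‖a k k x‖ := by linarith [hax k k, hη]
      _ ≤ ‖ev.mapMatrix D k k‖ := by
          rw [hent, Matrix.one_apply_eq]
          simpa using norm_sub_norm_le (1 : ℂ) (a k k x)
  · have hm : m ∈ Submodule.span C(X, ℂ) (Set.range s) := hs ▸ Submodule.mem_top
    induction hm using Submodule.span_induction with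
    | mem y hy =>
      obtain ⟨j, rfl⟩ := hy
      have : D.det • s j = ∑ i, D.adjugate j i • ∑ k, D i k • s k := by
        simp_rw [Finset.smul_sum, smul_smul]
        rw [Finset.sum_comm]
        simp_rw [← Finset.sum_smul, ← Matrix.mul_apply, Matrix.adjugate_mul]
        simp [Matrix.one_apply, ite_smul]
      rw [this]
      exact N.sum_mem fun i _ => N.smul_mem _ (hD i)
    | zero => simp
    | add y z _ _ hy hz => rw [smul_add]; exact N.add_mem hy hz
    | smul c y _ hy => rw [smul_comm]; exact N.smul_mem c hy

/-- With continuous fiber norms, linear independence in the fiber at `x` persists in a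
neighbourhood of `x`. -/
theorem exists_open_linearIndependent_fiber
    (hfib : ∀ m : M, Continuous fun x : X =>
      Metric.infDist m ((IY {x} • (⊤ : Submodule C(X, ℂ) M) : Submodule C(X, ℂ) M) : Set M))
    {κ : Type*} [Fintype κ] (v : κ → M) (x : X)
    (hv : ∀ c : κ → ℂ, ∑ k, c k • v k ∈
      closure ((IY {x} • (⊤ : Submodule C(X, ℂ) M) : Submodule C(X, ℂ) M) : Set M) → c = 0) :
    ∃ U : Set X, IsOpen U ∧ x ∈ U ∧ ∀ y ∈ U, ∀ c : κ → ℂ,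
      ∑ k, c k • v k ∈ IY {y} • (⊤ : Submodule C(X, ℂ) M) → c = 0 := by
  let F : (κ → ℂ) × X → ℝ := fun z => fiberNorm (∑ k, z.1 k • v k) z.2
  have hF : Continuous F := by
    have hsum : Continuous fun z : (κ → ℂ) × X => ∑ k, z.1 k • v k :=
      continuous_finsetSum _ fun k _ =>
        ((continuous_apply k).comp continuous_fst).smul continuous_const
    have h := (continuous_fiberNorm hfib).comp (hsum.prodMk continuous_snd)
    exact h
  obtain ⟨S, U, -, hU, hS, hxU, hSU⟩ := generalized_tube_lemma
    (isCompact_sphere (0 : κ → ℂ) 1) (isCompact_singleton (x := x))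
    (isOpen_lt continuous_const hF : IsOpen {z | 0 < F z}) (by
      rintro ⟨c, y⟩ ⟨hc, rfl : y = x⟩
      refine (Metric.infDist_pos_iff_notMem_closure ⟨0, Submodule.zero_mem _⟩).1 fun h => ?_
      have := hv c h
      simp [this] at hc)
  refine ⟨U, hU, hxU rfl, fun y hy c hc => ?_⟩
  by_contra hne
  have hn : ‖c‖ ≠ 0 := norm_ne_zero_iff.2 hne
  have hpos : 0 < F (((‖c‖ : ℂ)⁻¹) • c, y) :=
    hSU ⟨hS (by simp [norm_smul, hn]), hy⟩
  refine hpos.ne' (Metric.infDist_zero_of_mem ?_)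
  have heq : ∑ k, (((‖c‖ : ℂ)⁻¹) • c) k • v k = ((‖c‖ : ℂ)⁻¹) • ∑ k, c k • v k := by
    simp [Finset.smul_sum, mul_smul]
  rw [heq]
  exact Submodule.smul_of_tower_mem _ _ hc

/-- If a linear combination of `v` with function coefficients vanishes, then so does its fiber
value at each point. -/
theorem sum_apply_smul_mem_of_linearCombination_eq_zero {κ : Type*} [Fintype κ] (v : κ → M)
    {g : κ → C(X, ℂ)} (hg : Fintype.linearCombination C(X, ℂ) v g = 0) (y : X) :
    ∑ k, g k y • v k ∈ IY {y} • (⊤ : Submodule C(X, ℂ) M) := by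
  have : ∑ k, g k y • v k = ∑ k, (g k y • (1 : C(X, ℂ)) - g k) • v k := by
    rw [Fintype.linearCombination_apply] at hg
    simp [sub_smul, Finset.sum_sub_distrib, hg]
  rw [this]
  refine Submodule.sum_mem _ fun k _ => Submodule.smul_mem_smul ?_ Submodule.mem_top
  simp [mem_IY_singleton]

/-- Near each point, multiplication by some function factors through a finite free module. -/
theorem exists_local_factorization [T2Space X] [CompleteSpace M]
    (hnorm : ∀ (f : C(X, ℂ)) (m : M), ‖f • m‖ ≤ ‖f‖ * ‖m‖)
    (hfib : ∀ m : M, Continuous fun x : X =>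
      Metric.infDist m ((IY {x} • (⊤ : Submodule C(X, ℂ) M) : Submodule C(X, ℂ) M) : Set M))
    (hfg : Module.Finite C(X, ℂ) M) (x : X) :
    ∃ r : C(X, ℂ), r x ≠ 0 ∧ ∃ k : ℕ, ∃ (q : (Fin k → C(X, ℂ)) →ₗ[C(X, ℂ)] M)
      (σ : M →ₗ[C(X, ℂ)] (Fin k → C(X, ℂ))), ∀ m, q (σ m) = r • m := by
  obtain ⟨n, s, hs⟩ := Module.Finite.exists_fin (R := C(X, ℂ)) (M := M)
  let Z : Submodule ℂ M :=
    ((IY {x} • (⊤ : Submodule C(X, ℂ) M)).restrictScalars ℂ).topologicalClosure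
  obtain ⟨κ, e, he, hspan, hli⟩ := exists_linearIndependent' ℂ fun j => Z.mkQ (s j)
  have : Finite κ := Finite.of_injective e he
  obtain ⟨k, ⟨φ⟩⟩ := Finite.exists_equiv_fin κ
  let v : Fin k → M := fun i => s (e (φ.symm i))
  have hv : ∀ c : Fin k → ℂ, ∑ i, c i • v i ∈
      closure ((IY {x} • (⊤ : Submodule C(X, ℂ) M) : Submodule C(X, ℂ) M) : Set M) → c = 0 := by
    intro c hc
    have hli' := Fintype.linearIndependent_iff.1 (hli.comp φ.symm φ.symm.injective) c
    refine funext (hli' ?_)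
    have hc' : Z.mkQ (∑ i, c i • v i) = 0 := (Submodule.Quotient.mk_eq_zero Z).2 hc
    rw [map_sum] at hc'
    simp only [map_smul] at hc'
    exact hc'
  obtain ⟨U, hU, hxU, hind⟩ := exists_open_linearIndependent_fiber hfib v x hv
  let q := Fintype.linearCombination C(X, ℂ) v
  obtain ⟨u, hux, hu⟩ := exists_smul_mem_of_mem_closure hnorm hs x (LinearMap.range q) fun j => by
    have hj : Z.mkQ (s j) ∈ Submodule.span ℂ (Set.range fun i => Z.mkQ (v i)) := by
      have hr : (Set.range fun i => Z.mkQ (v i)) = Set.range ((fun j => Z.mkQ (s j)) ∘ e) :=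
        φ.symm.surjective.range_comp ((fun j => Z.mkQ (s j)) ∘ e)
      rw [hr, hspan]
      exact Submodule.subset_span ⟨j, rfl⟩
    obtain ⟨c, hc⟩ := (Submodule.mem_span_range_iff_exists_fun ℂ).1 hj
    refine ⟨∑ i, c i • v i, ⟨fun i => c i • 1, ?_⟩, ?_⟩
    · simp [q, Fintype.linearCombination_apply]
    · refine (Submodule.Quotient.mk_eq_zero Z).1 ?_
      change Z.mkQ (s j - ∑ i, c i • v i) = 0
      rw [map_sub, map_sum, sub_eq_zero, ← hc]
      simp only [map_smul]
  obtain ⟨f, hf0, hf1, -⟩ := exists_continuous_zero_one_of_isClosed hU.isClosed_compl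
    (isClosed_singleton (x := x)) (by simpa using hxU)
  obtain ⟨σ, hσ⟩ := exists_factorization_of_smul q (ofRealCM f) u (fun g hg => by
    ext i y
    by_cases hy : y ∈ U
    · have := hind y hy _ (sum_apply_smul_mem_of_linearCombination_eq_zero v hg y)
      simp [show g i y = 0 from congrFun this i]
    · simp [ofRealCM, show f y = 0 from hf0 hy]) hu
  refine ⟨ofRealCM f * u, ?_, k, q, σ, hσ⟩
  simp [ofRealCM, show f x = 1 from hf1 rfl, hux]

end

/-- A unital Banach `C(X,ℂ)`-module over a compact Hausdorff space `X` which is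
`C(X)`-convex and has continuous fiber norms (i.e. is the section module of a
continuous (F) Banach bundle) and is algebraically finitely generated is
finitely generated projective. -/
theorem stmt0 {X M : Type*} [TopologicalSpace X] [CompactSpace X] [T2Space X]
    [NormedAddCommGroup M] [CompleteSpace M] [NormedSpace ℂ M]
    [Module C(X, ℂ) M] [IsScalarTower ℂ C(X, ℂ) M]
    (hnorm : ∀ (f : C(X, ℂ)) (m : M), ‖f • m‖ ≤ ‖f‖ * ‖m‖)
    (hconv : ∀ f : C(X, ℝ), (∀ x, f x ∈ Set.Icc (0 : ℝ) 1) →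
      ∀ m m' : M, ‖ofRealCM f • m + (1 - ofRealCM f) • m'‖ ≤ max ‖m‖ ‖m'‖)
    (hfib : ∀ m : M, Continuous fun x : X =>
      Metric.infDist m ((IY {x} • (⊤ : Submodule C(X, ℂ) M) : Submodule C(X, ℂ) M) : Set M))
    (hfg : Module.Finite C(X, ℂ) M) :
    Module.Projective C(X, ℂ) M := by
  refine projective_of_local_factorization fun I hI => ?_
  have : IsClosed (I : Set C(X, ℂ)) := hI.isClosed
  obtain ⟨x, rfl⟩ := (ContinuousMap.ideal_isMaximal_iff I).1 hI
  obtain ⟨r, hr, h⟩ := exists_local_factorization hnorm hfib hfg x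
  exact ⟨r, fun hmem => hr ((ContinuousMap.mem_idealOfSet_compl_singleton x r).1 hmem), h⟩
end

section
/- Let X be a compact Hausdorff space and M a unital Banach C(X,ℂ)-module that is C(X)-convex, has continuous fiber norms, and is topologically finitely generated. Then every C(X,ℂ)-linear map T : M → E, where E is any complex Banach space equipped with a (not necessarily unital) C(X,ℂ)-module structure satisfying ‖f • e‖ ≤ ‖f‖·‖e‖, is automatically continuous. -/
open Topology Filter

section FiberSeminorm

variable {X M : Type*} [TopologicalSpace X]
  [NormedAddCommGroup M] [NormedSpace ℂ M] [Module C(X, ℂ) M] [IsScalarTower ℂ C(X, ℂ) M]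

variable (M) in
/-- The kernel of the projection of `M` onto its fiber at `x`. -/
noncomputable def fiberKernel (x : X) : Submodule ℂ M :=
  ((IY {x} • (⊤ : Submodule C(X, ℂ) M)).restrictScalars ℂ).topologicalClosure

instance isClosed_fiberKernel (x : X) : IsClosed (fiberKernel M x : Set M) :=
  Submodule.isClosed_topologicalClosure _

variable (M) in
/-- The seminorm on `M` induced by the norm of its fiber at `x`. -/
noncomputable def fiberSeminorm (x : X) : Seminorm ℂ M :=
  (normSeminorm ℂ (M ⧸ fiberKernel M x)).comp (fiberKernel M x).mkQ

theorem fiberSeminorm_eq_norm_mk (x : X) (m : M) :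
    fiberSeminorm M x m = ‖(fiberKernel M x).mkQ m‖ := rfl

theorem fiberSeminorm_apply (x : X) (m : M) :
    fiberSeminorm M x m = Metric.infDist m
      ((IY {x} • (⊤ : Submodule C(X, ℂ) M) : Submodule C(X, ℂ) M) : Set M) :=
  (QuotientAddGroup.norm_mk (S := (fiberKernel M x).toAddSubgroup) m).trans
    Metric.infDist_closure

theorem fiberSeminorm_le_norm (x : X) (m : M) : fiberSeminorm M x m ≤ ‖m‖ :=
  Submodule.Quotient.norm_mk_le (fiberKernel M x) m

theorem fiberSeminorm_eq_zero_iff {x : X} {m : M} :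
    fiberSeminorm M x m = 0 ↔ m ∈ fiberKernel M x := by
  rw [fiberSeminorm_eq_norm_mk, norm_eq_zero, Submodule.mkQ_apply,
    Submodule.Quotient.mk_eq_zero]

theorem mkQ_fiberKernel_smul (x : X) (f : C(X, ℂ)) (m : M) :
    (fiberKernel M x).mkQ (f • m) = f x • (fiberKernel M x).mkQ m := by
  rw [← map_smul, ← sub_eq_zero, ← map_sub, Submodule.mkQ_apply, Submodule.Quotient.mk_eq_zero]
  refine Submodule.le_topologicalClosure _ ?_
  have h : f • m - f x • m = (f - f x • (1 : C(X, ℂ))) • m := by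
    rw [sub_smul, smul_assoc, one_smul]
  rw [h, Submodule.restrictScalars_mem]
  refine Submodule.smul_mem_smul ?_ trivial
  rintro y rfl
  simp

theorem fiberSeminorm_smul (x : X) (f : C(X, ℂ)) (m : M) :
    fiberSeminorm M x (f • m) = ‖f x‖ * fiberSeminorm M x m := by
  simp only [fiberSeminorm_eq_norm_mk, mkQ_fiberKernel_smul, norm_smul]

end FiberSeminorm

section Convexity

variable {X M : Type*} [TopologicalSpace X] [CompactSpace X]
  [NormedAddCommGroup M] [Module C(X, ℂ) M]

/-- Elements of `I_x • M` are small near `x`. -/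
theorem exists_nhds_norm_smul_le
    (hnorm : ∀ (f : C(X, ℂ)) (m : M), ‖f • m‖ ≤ ‖f‖ * ‖m‖) {x : X} {p : M}
    (hp : p ∈ (IY {x} • (⊤ : Submodule C(X, ℂ) M) : Submodule C(X, ℂ) M)) :
    ∀ ε > 0, ∃ N ∈ 𝓝 x, ∀ u : C(X, ℂ), (∀ y, ‖u y‖ ≤ 1) → (∀ y ∉ N, u y = 0) →
      ‖u • p‖ ≤ ε := by
  refine Submodule.smul_induction_on hp (fun f hf n _ ε hε => ?_) (fun p q hp hq ε hε => ?_)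
  · have hδ : 0 < ε / (‖n‖ + 1) := by positivity
    refine ⟨{y | ‖f y‖ < ε / (‖n‖ + 1)}, ?_, fun u hu hN => ?_⟩
    · refine (isOpen_lt (by fun_prop) continuous_const).mem_nhds ?_
      simpa [hf x rfl] using hδ
    · rw [smul_smul]
      refine (hnorm _ _).trans ?_
      have h : ‖u * f‖ ≤ ε / (‖n‖ + 1) := by
        refine (ContinuousMap.norm_le _ hδ.le).2 fun y => ?_
        by_cases hy : y ∈ {y | ‖f y‖ < ε / (‖n‖ + 1)}
        · have : ‖f y‖ < ε / (‖n‖ + 1) := hy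
          have := mul_le_mul (hu y) this.le (norm_nonneg _) zero_le_one
          simpa using this
        · simpa [hN y hy] using hδ.le
      calc ‖u * f‖ * ‖n‖ ≤ ε / (‖n‖ + 1) * (‖n‖ + 1) := by gcongr; linarith
        _ = ε := by field_simp
  · obtain ⟨N, hN, h⟩ := hp (ε / 2) (by positivity)
    obtain ⟨N', hN', h'⟩ := hq (ε / 2) (by positivity)
    refine ⟨N ∩ N', inter_mem hN hN', fun u hu hu0 => ?_⟩
    rw [smul_add]
    have h1 := h u hu fun y hy => hu0 y fun hy' => hy hy'.1
    have h2 := h' u hu fun y hy => hu0 y fun hy' => hy hy'.2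
    linarith [norm_add_le (u • p) (u • q)]

theorem norm_ofRealCM_sup_smul_le
    (hnorm : ∀ (f : C(X, ℂ)) (m : M), ‖f • m‖ ≤ ‖f‖ * ‖m‖)
    (hconv : ∀ f : C(X, ℝ), (∀ x, f x ∈ Set.Icc (0 : ℝ) 1) →
      ∀ m m' : M, ‖ofRealCM f • m + (1 - ofRealCM f) • m'‖ ≤ max ‖m‖ ‖m'‖)
    {m : M} {C : ℝ} {u v : C(X, ℝ)}
    (hu : ‖ofRealCM u • m‖ ≤ C) (hv : ‖ofRealCM v • m‖ ≤ C) :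
    ‖ofRealCM (u ⊔ v) • m‖ ≤ C := by
  refine le_of_forall_pos_le_add fun ε hε => ?_
  have hδ : 0 < ε / (‖m‖ + 1) := by positivity
  set δ := ε / (‖m‖ + 1) with hδ_def
  let ρ : C(X, ℝ) := ⟨fun x => max 0 (min 1 ((u x - v x) / δ)), by fun_prop⟩
  have hρ : ∀ x, ρ x ∈ Set.Icc (0 : ℝ) 1 := fun x =>
    ⟨le_max_left _ _, max_le zero_le_one (min_le_left _ _)⟩
  have hw := (hconv ρ hρ (ofRealCM u • m) (ofRealCM v • m)).trans (max_le hu hv)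
  rw [smul_smul, smul_smul, ← add_smul] at hw
  have hd : ‖ofRealCM (u ⊔ v) - (ofRealCM ρ * ofRealCM u + (1 - ofRealCM ρ) * ofRealCM v)‖ ≤ δ := by
    refine (ContinuousMap.norm_le _ hδ.le).2 fun x => ?_
    have h : (ofRealCM (u ⊔ v) - (ofRealCM ρ * ofRealCM u + (1 - ofRealCM ρ) * ofRealCM v)) x
        = ((max (u x) (v x) - (ρ x * u x + (1 - ρ x) * v x) : ℝ) : ℂ) := by
      simp [ofRealCM]
    rw [h, Complex.norm_real, Real.norm_eq_abs]
    have hρx : ρ x = max 0 (min 1 ((u x - v x) / δ)) := rfl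
    rcases le_total (u x) (v x) with huv | huv
    · have : ρ x = 0 := by
        rw [hρx, max_eq_left]
        exact (min_le_right _ _).trans (div_nonpos_of_nonpos_of_nonneg (by linarith) hδ.le)
      simp [this, huv, hδ.le]
    · rw [max_eq_left huv]
      have h1 := hρ x
      rcases le_total δ (u x - v x) with h2 | h2
      · have : ρ x = 1 := by
          rw [hρx, min_eq_left ((one_le_div hδ).2 h2), max_eq_right zero_le_one]
        simp [this, hδ.le]
      · rw [abs_le]
        constructor <;> nlinarith [h1.1, h1.2]
  calc ‖ofRealCM (u ⊔ v) • m‖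
      = ‖(ofRealCM ρ * ofRealCM u + (1 - ofRealCM ρ) * ofRealCM v) • m +
          (ofRealCM (u ⊔ v) - (ofRealCM ρ * ofRealCM u + (1 - ofRealCM ρ) * ofRealCM v)) • m‖ := by
        rw [← add_smul, add_sub_cancel]
    _ ≤ C + δ * ‖m‖ := (norm_add_le _ _).trans
        (add_le_add hw ((hnorm _ _).trans (by gcongr)))
    _ ≤ C + δ * (‖m‖ + 1) := by gcongr; linarith
    _ = C + ε := by rw [hδ_def]; field_simp

variable [T2Space X] [NormedSpace ℂ M] [IsScalarTower ℂ C(X, ℂ) M]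

theorem norm_le_of_fiberSeminorm_lt
    (hnorm : ∀ (f : C(X, ℂ)) (m : M), ‖f • m‖ ≤ ‖f‖ * ‖m‖)
    (hconv : ∀ f : C(X, ℝ), (∀ x, f x ∈ Set.Icc (0 : ℝ) 1) →
      ∀ m m' : M, ‖ofRealCM f • m + (1 - ofRealCM f) • m'‖ ≤ max ‖m‖ ‖m'‖)
    {m : M} {C : ℝ} (hC : 0 ≤ C) (h : ∀ x : X, fiberSeminorm M x m < C) : ‖m‖ ≤ C := by
  suffices H : ∃ u : C(X, ℝ), (∀ x, u x ∈ Set.Icc (0 : ℝ) 1) ∧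
      (∀ x ∈ (Set.univ : Set X), u x = 1) ∧ ‖ofRealCM u • m‖ ≤ C by
    obtain ⟨u, -, hu, hum⟩ := H
    have hu_one : ofRealCM u = 1 := by ext x; simp [ofRealCM, hu x trivial]
    rwa [hu_one, one_smul] at hum
  refine isCompact_univ.induction_on (p := fun K => ∃ u : C(X, ℝ),
      (∀ x, u x ∈ Set.Icc (0 : ℝ) 1) ∧ (∀ x ∈ K, u x = 1) ∧ ‖ofRealCM u • m‖ ≤ C) ?_ ?_ ?_ ?_
  · refine ⟨0, by simp, by simp, ?_⟩
    have : ofRealCM (0 : C(X, ℝ)) = 0 := by ext; simp [ofRealCM]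
    simpa [this] using hC
  · rintro K L hKL ⟨u, hu, hu1, hum⟩
    exact ⟨u, hu, fun x hx => hu1 x (hKL hx), hum⟩
  · rintro K L ⟨u, hu, hu1, hum⟩ ⟨v, hv, hv1, hvm⟩
    refine ⟨u ⊔ v, fun x => ⟨?_, ?_⟩, ?_, norm_ofRealCM_sup_smul_le hnorm hconv hum hvm⟩
    · exact (hu x).1.trans le_sup_left
    · exact sup_le (hu x).2 (hv x).2
    · rintro x (hx | hx)
      · simp [hu1 x hx, (hv x).2]
      · simp [hv1 x hx, (hu x).2]
  · intro x _
    have hx := h x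
    rw [fiberSeminorm_apply, Metric.infDist_lt_iff ⟨0, Submodule.zero_mem _⟩] at hx
    obtain ⟨p, hp, hmp⟩ := hx
    rw [dist_eq_norm] at hmp
    obtain ⟨N, hN, hNu⟩ := exists_nhds_norm_smul_le hnorm hp (C - ‖m - p‖) (by linarith)
    obtain ⟨K, hK, hKc, hKN⟩ := exists_mem_nhds_isClosed_subset (interior_mem_nhds.2 hN)
    obtain ⟨u, hu0, hu1, hu⟩ := exists_continuous_zero_one_of_isClosed
      isOpen_interior.isClosed_compl hKc (Set.disjoint_compl_left_iff_subset.2 hKN)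
    refine ⟨K, mem_nhdsWithin_of_mem_nhds hK, u, hu, fun y hy => hu1 hy, ?_⟩
    have hu_norm : ∀ y, ‖ofRealCM u y‖ ≤ 1 := fun y => by
      simpa [ofRealCM, abs_of_nonneg (hu y).1] using (hu y).2
    have h1 := hNu (ofRealCM u) hu_norm fun y hy => by
      simpa [ofRealCM] using hu0 fun hy' => hy (interior_subset hy')
    have h2 : ‖ofRealCM u • (m - p)‖ ≤ ‖m - p‖ := by
      refine (hnorm _ _).trans (mul_le_of_le_one_left (norm_nonneg _) ?_)
      exact (ContinuousMap.norm_le _ zero_le_one).2 hu_norm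
    calc ‖ofRealCM u • m‖ = ‖ofRealCM u • (m - p) + ofRealCM u • p‖ := by
          rw [← smul_add, sub_add_cancel]
      _ ≤ ‖m - p‖ + (C - ‖m - p‖) := (norm_add_le _ _).trans (add_le_add h2 h1)
      _ = C := by ring

theorem norm_le_of_fiberSeminorm_le
    (hnorm : ∀ (f : C(X, ℂ)) (m : M), ‖f • m‖ ≤ ‖f‖ * ‖m‖)
    (hconv : ∀ f : C(X, ℝ), (∀ x, f x ∈ Set.Icc (0 : ℝ) 1) →
      ∀ m m' : M, ‖ofRealCM f • m + (1 - ofRealCM f) • m'‖ ≤ max ‖m‖ ‖m'‖)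
    {m : M} {C : ℝ} (hC : 0 ≤ C) (h : ∀ x : X, fiberSeminorm M x m ≤ C) : ‖m‖ ≤ C :=
  le_of_forall_pos_le_add fun ε hε => norm_le_of_fiberSeminorm_lt hnorm hconv (by positivity)
    fun x => (h x).trans_lt (by linarith)

/-- Every element is a multiple of a function that vanishes wherever the element does. -/
theorem exists_eq_smul_of_fiberSeminorm_eq_zero [CompleteSpace M]
    (hnorm : ∀ (f : C(X, ℂ)) (m : M), ‖f • m‖ ≤ ‖f‖ * ‖m‖)
    (hconv : ∀ f : C(X, ℝ), (∀ x, f x ∈ Set.Icc (0 : ℝ) 1) →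
      ∀ m m' : M, ‖ofRealCM f • m + (1 - ofRealCM f) • m'‖ ≤ max ‖m‖ ‖m'‖)
    {m : M} (hm : Continuous fun x : X => fiberSeminorm M x m) :
    ∃ (h : C(X, ℂ)) (m' : M), m = h • m' ∧ ∀ x, fiberSeminorm M x m = 0 → h x = 0 := by
  let r : C(X, ℝ) := ⟨fun x => √(fiberSeminorm M x m), by fun_prop⟩
  have hr0 : ∀ x, 0 ≤ r x := fun x => Real.sqrt_nonneg _
  have hrm : ∀ x, fiberSeminorm M x m = r x * r x := fun x =>
    (Real.mul_self_sqrt (apply_nonneg _ _)).symm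
  let ε : ℕ → ℝ := fun n => 1 / ((n : ℝ) + 1)
  have hε : ∀ n, 0 < ε n := fun n => Nat.one_div_pos_of_nat
  have hε_lim : Tendsto ε atTop (𝓝 0) := tendsto_one_div_add_atTop_nhds_zero_nat
  have hpos : ∀ n x, 0 < r x + ε n := fun n x => add_pos_of_nonneg_of_pos (hr0 x) (hε n)
  let φ : ℕ → C(X, ℝ) := fun n =>
    ⟨fun x => (r x + ε n)⁻¹, (by fun_prop : Continuous fun x => r x + ε n).inv₀
      fun x => (hpos n x).ne'⟩
  have hφ : ∀ n x, φ n x = (r x + ε n)⁻¹ := fun _ _ => rfl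
  have hdist : ∀ k l, ‖ofRealCM (φ k) • m - ofRealCM (φ l) • m‖ ≤ |ε k - ε l| := fun k l => by
    refine norm_le_of_fiberSeminorm_le hnorm hconv (abs_nonneg _) fun x => ?_
    have h1 : ‖(ofRealCM (φ k) - ofRealCM (φ l)) x‖ = |φ k x - φ l x| := by
      rw [← Real.norm_eq_abs, ← Complex.norm_real]
      simp [ofRealCM]
    have hk := hpos k x
    have hl := hpos l x
    have h2 : φ k x - φ l x = (ε l - ε k) / ((r x + ε k) * (r x + ε l)) := by
      rw [hφ, hφ]; field_simp; ring
    rw [← sub_smul, fiberSeminorm_smul, h1, h2, hrm, abs_div, abs_sub_comm (ε l),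
      abs_of_pos (mul_pos hk hl), div_mul_eq_mul_div]
    refine div_le_of_le_mul₀ (by positivity) (abs_nonneg _) ?_
    gcongr <;> linarith [hr0 x, hε k, hε l]
  have hcauchy : CauchySeq fun n => ofRealCM (φ n) • m := by
    refine Metric.cauchySeq_iff.2 fun δ hδ => ?_
    obtain ⟨N, hN⟩ := Metric.cauchySeq_iff.1 hε_lim.cauchySeq δ hδ
    refine ⟨N, fun k hk l hl => ?_⟩
    rw [dist_eq_norm]
    exact (hdist k l).trans_lt (hN k hk l hl)
  obtain ⟨m', hm'⟩ := cauchySeq_tendsto_of_complete hcauchy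
  refine ⟨ofRealCM r, m', ?_, fun x hx => ?_⟩
  · have hleft : Tendsto (fun n => ofRealCM r • ofRealCM (φ n) • m) atTop
        (𝓝 (ofRealCM r • m')) := by
      rw [tendsto_iff_norm_sub_tendsto_zero] at hm' ⊢
      refine squeeze_zero (fun _ => norm_nonneg _) (fun n => ?_)
        (by simpa using hm'.const_mul ‖ofRealCM r‖)
      rw [← smul_sub]
      exact hnorm _ _
    have hright : Tendsto (fun n => ofRealCM r • ofRealCM (φ n) • m) atTop (𝓝 m) := by
      rw [tendsto_iff_norm_sub_tendsto_zero]
      refine squeeze_zero (fun _ => norm_nonneg _) (fun n => ?_)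
        (by simpa using hε_lim.mul_const ‖r‖)
      refine norm_le_of_fiberSeminorm_le hnorm hconv
        (mul_nonneg (hε n).le (norm_nonneg _)) fun x => ?_
      have hn := hpos n x
      have h1 : ‖(ofRealCM r * ofRealCM (φ n) - 1) x‖ = |r x * φ n x - 1| := by
        rw [← Real.norm_eq_abs, ← Complex.norm_real]
        simp [ofRealCM]
      have h2 : r x * φ n x - 1 = -(ε n / (r x + ε n)) := by
        rw [hφ]; field_simp; ring
      have h3 : ofRealCM r • ofRealCM (φ n) • m - m
          = (ofRealCM r * ofRealCM (φ n) - 1) • m := by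
        rw [sub_smul, one_smul, smul_smul]
      rw [h3, fiberSeminorm_smul, h1, h2, hrm, abs_neg, abs_of_pos (div_pos (hε n) hn),
        div_mul_eq_mul_div]
      refine div_le_of_le_mul₀ hn.le (mul_nonneg (hε n).le (norm_nonneg _)) ?_
      have h4 : r x ≤ ‖r‖ := (Real.le_norm_self _).trans (r.norm_coe_le_norm x)
      have h5 := hε n
      have h6 := hr0 x
      rw [mul_assoc]
      gcongr
      linarith
    exact tendsto_nhds_unique hright hleft
  · have : r x = 0 := by simp [r, hx]
    simp [ofRealCM, this]

end Convexity

section LocalFrame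

variable {X M : Type*} [TopologicalSpace X]
  [NormedAddCommGroup M] [NormedSpace ℂ M] [Module C(X, ℂ) M] [IsScalarTower ℂ C(X, ℂ) M]

theorem continuous_fiberSeminorm_prod
    (hfib : ∀ m : M, Continuous fun x : X => fiberSeminorm M x m) :
    Continuous fun p : X × M => fiberSeminorm M p.1 p.2 :=
  continuous_prod_of_continuous_lipschitzWith' _ 1
    (fun x => LipschitzWith.of_dist_le_mul fun m m' => by
      rw [Real.dist_eq, dist_eq_norm, NNReal.coe_one, one_mul]
      exact (abs_sub_map_le_sub _ m m').trans (fiberSeminorm_le_norm x _)) hfib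

theorem linearIndepOn_mkQ_fiberKernel_iff {x : X} {t : Finset M} :
    LinearIndepOn ℂ (fiberKernel M x).mkQ (t : Set M) ↔
      ∀ c : t → ℂ, fiberSeminorm M x (∑ i, c i • (i : M)) = 0 → c = 0 := by
  have h := Fintype.linearIndependent_iff (R := ℂ)
    (v := fun i : (t : Set M) => (fiberKernel M x).mkQ (i : M))
  refine h.trans (forall_congr' fun c => ?_)
  rw [fiberSeminorm_eq_norm_mk, norm_eq_zero, funext_iff, map_sum]
  simp only [map_smul]
  rfl

theorem LinearIndepOn.exists_eventually_le_fiberSeminorm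
    (hfib : ∀ m : M, Continuous fun x : X => fiberSeminorm M x m) {x : X} {t : Finset M}
    (ht : LinearIndepOn ℂ (fiberKernel M x).mkQ (t : Set M)) :
    ∃ δ > 0, ∀ᶠ y in 𝓝 x, ∀ c : t → ℂ, δ * ‖c‖ ≤ fiberSeminorm M y (∑ i, c i • (i : M)) := by
  rw [linearIndepOn_mkQ_fiberKernel_iff] at ht
  have hcont : Continuous fun p : X × (t → ℂ) =>
      fiberSeminorm M p.1 (∑ i, p.2 i • (i : M)) :=
    (continuous_fiberSeminorm_prod hfib).comp
      (f := fun p : X × (t → ℂ) => (p.1, ∑ i, p.2 i • (i : M))) (by fun_prop)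
  have hK : IsCompact (Metric.sphere (0 : t → ℂ) 1) := isCompact_sphere _ _
  obtain ⟨δ, hδ, hle⟩ := hK.exists_forall_le' (a := 0)
    (f := fun c : t → ℂ => fiberSeminorm M x (∑ i, c i • (i : M)))
    (hcont.comp (by fun_prop : Continuous fun c : t → ℂ => (x, c))).continuousOn fun c hc => by
      refine (apply_nonneg _ _).lt_of_ne' fun h0 => ?_
      simp [ht c h0] at hc
  refine ⟨δ / 2, half_pos hδ, ?_⟩
  have hev := hK.eventually_forall_of_forall_eventually (x₀ := x)
    (P := fun y c => δ / 2 < fiberSeminorm M y (∑ i, c i • (i : M))) fun c hc =>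
      (isOpen_lt continuous_const hcont).mem_nhds (by
        change δ / 2 < fiberSeminorm M x (∑ i, c i • (i : M))
        linarith [hle c hc])
  filter_upwards [hev] with y hy c
  rcases eq_or_ne c 0 with rfl | hc
  · simp
  have hc' : 0 < ‖c‖ := norm_pos_iff.2 hc
  have h1 := hy ((‖c‖⁻¹ : ℂ) • c) (by simp [norm_smul, hc'.ne'])
  have h2 : ∑ i, ((‖c‖⁻¹ : ℂ) • c) i • (i : M) = (‖c‖⁻¹ : ℂ) • ∑ i, c i • (i : M) := by
    simp [Finset.smul_sum, smul_smul]
  rw [h2, map_smul_eq_mul, norm_inv, Complex.norm_real, norm_norm, inv_mul_eq_div,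
    lt_div_iff₀ hc'] at h1
  exact h1.le

theorem exists_fiberSeminorm_sub_sum_eq_zero {s t : Finset M}
    (hs : Dense ((Submodule.span C(X, ℂ) (s : Set M) : Submodule C(X, ℂ) M) : Set M)) {y : X}
    (h : ∀ a ∈ s, (fiberKernel M y).mkQ a ∈
      Submodule.span ℂ ((fiberKernel M y).mkQ '' (t : Set M))) (m : M) :
    ∃ c : t → ℂ, fiberSeminorm M y (m - ∑ i, c i • (i : M)) = 0 := by
  set W := Submodule.span ℂ ((fiberKernel M y).mkQ '' (t : Set M)) with hW
  have : FiniteDimensional ℂ W := FiniteDimensional.span_of_finite ℂ (t.finite_toSet.image _)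
  have hcont : Continuous (fiberKernel M y).mkQ :=
    AddMonoidHomClass.continuous_of_bound _ 1 fun m =>
      (fiberSeminorm_le_norm y m).trans_eq (one_mul _).symm
  have hclosed : IsClosed ((fiberKernel M y).mkQ ⁻¹' (W : Set _)) :=
    W.closed_of_finiteDimensional.preimage hcont
  have hspan : ((Submodule.span C(X, ℂ) (s : Set M) : Submodule C(X, ℂ) M) : Set M) ⊆
      (fiberKernel M y).mkQ ⁻¹' (W : Set _) := fun a ha => by
    refine Submodule.span_induction (p := fun a _ => (fiberKernel M y).mkQ a ∈ W)
      (fun a ha => h a ha) ?_ (fun a b _ _ ha hb => ?_) (fun f a _ ha => ?_) ha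
    · rw [map_zero]; exact W.zero_mem
    · rw [map_add]; exact W.add_mem ha hb
    · rw [mkQ_fiberKernel_smul]; exact W.smul_mem _ ha
  have hm : (fiberKernel M y).mkQ m ∈ W := hclosed.closure_subset_iff.2 hspan (hs m)
  rw [hW, Submodule.span_image] at hm
  obtain ⟨w, hw, hwm⟩ := hm
  obtain ⟨c, rfl⟩ := Submodule.mem_span_finset'.1 hw
  exact ⟨c, by rw [fiberSeminorm_eq_norm_mk, map_sub, hwm, sub_self, norm_zero]⟩

/-- Near a point `x` of a closed set `Z` where `t` is a frame of all nearby fibers over `Z`, the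
elements of `M` have coordinates depending boundedly on them. -/
theorem exists_local_coordinates [CompactSpace X] [T2Space X]
    (hfib : ∀ m : M, Continuous fun x : X => fiberSeminorm M x m)
    {Z : Set X} (hZ : IsClosed Z) {x : X} {t : Finset M}
    (ht : LinearIndepOn ℂ (fiberKernel M x).mkQ (t : Set M))
    (hspan : ∀ y ∈ Z, LinearIndepOn ℂ (fiberKernel M y).mkQ (t : Set M) →
      ∀ m : M, ∃ c : t → ℂ, fiberSeminorm M y (m - ∑ i, c i • (i : M)) = 0) :
    ∃ (f : C(X, ℂ)) (B : ℝ), f x = 1 ∧ ∀ m : M, ∃ g : t → C(X, ℂ),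
      (∀ i, ‖g i‖ ≤ B * ‖m‖) ∧ ∀ y ∈ Z, fiberSeminorm M y (f • m - ∑ i, g i • (i : M)) = 0 := by
  obtain ⟨δ, hδ, hev⟩ := ht.exists_eventually_le_fiberSeminorm hfib
  obtain ⟨K, hK, hKc, hKV⟩ := exists_mem_nhds_isClosed_subset hev
  obtain ⟨u, hu0, hu1, hu⟩ := exists_continuous_zero_one_of_isClosed
    isOpen_interior.isClosed_compl (isClosed_singleton (x := x))
    (Set.disjoint_singleton_right.2 fun h => h (mem_interior_iff_mem_nhds.2 hK))
  have hf_norm : ‖ofRealCM u‖ ≤ 1 := (ContinuousMap.norm_le _ zero_le_one).2 fun y => by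
    simpa [ofRealCM, abs_of_nonneg (hu y).1] using (hu y).2
  refine ⟨ofRealCM u, δ⁻¹, by simpa [ofRealCM] using hu1 rfl, fun m => ?_⟩
  have hc : ∀ y : (K ∩ Z : Set X), ∃ c : t → ℂ,
      fiberSeminorm M (y : X) (m - ∑ i, c i • (i : M)) = 0 := fun y => by
    refine hspan y y.2.2 (linearIndepOn_mkQ_fiberKernel_iff.2 fun c hc0 => ?_) m
    have := (hKV y.2.1 c).trans_eq hc0
    exact norm_le_zero_iff.1 (nonpos_of_mul_nonpos_right this hδ)
  choose c hc using hc
  have hbound : ∀ y, ‖c y‖ ≤ δ⁻¹ * ‖m‖ := fun y => by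
    rw [inv_mul_eq_div, le_div_iff₀' hδ]
    refine (hKV y.2.1 (c y)).trans ?_
    have h1 := map_sub_le_add (fiberSeminorm M (y : X)) m (m - ∑ i, c y i • (i : M))
    rw [sub_sub_cancel, hc y, add_zero] at h1
    exact h1.trans (fiberSeminorm_le_norm _ _)
  have hcont : Continuous c := by
    refine continuous_iff_continuousAt.2 fun y₀ => Metric.tendsto_nhds.2 fun ε hε => ?_
    have h0 : Continuous fun y : (K ∩ Z : Set X) =>
        fiberSeminorm M (y : X) (m - ∑ i, c y₀ i • (i : M)) :=
      (hfib _).comp continuous_subtype_val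
    have h1 := h0.tendsto y₀
    rw [hc y₀] at h1
    filter_upwards [h1.eventually_lt_const (mul_pos hδ hε)] with y hy
    rw [dist_eq_norm]
    refine lt_of_mul_lt_mul_left (((hKV y.2.1 (c y - c y₀)).trans ?_).trans_lt hy) hδ.le
    have h2 : ∑ i, (c y - c y₀) i • (i : M) =
        (m - ∑ i, c y₀ i • (i : M)) - (m - ∑ i, c y i • (i : M)) := by
      simp [sub_smul]
    rw [h2]
    exact (map_sub_le_add _ _ _).trans_eq (by rw [hc y, add_zero])
  obtain ⟨G, hGn, hG⟩ := BoundedContinuousFunction.exists_norm_eq_domRestrict_eq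
    (hKc.inter hZ) ℂ (BoundedContinuousFunction.ofNormedAddCommGroup c hcont _ hbound)
  have hGc : ∀ y : (K ∩ Z : Set X), G y = c y := fun y => DFunLike.congr_fun hG y
  have hGB : ‖G‖ ≤ δ⁻¹ * ‖m‖ := hGn.trans_le
    (BoundedContinuousFunction.norm_ofNormedAddCommGroup_le _ (by positivity) hbound)
  refine ⟨fun i => ofRealCM u * ⟨fun y => G y i, by fun_prop⟩, fun i => ?_, fun y hy => ?_⟩
  · refine (norm_mul_le _ _).trans ((mul_le_of_le_one_left (norm_nonneg _) hf_norm).trans ?_)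
    refine (ContinuousMap.norm_le _ (by positivity)).2 fun y => ?_
    exact (norm_le_pi_norm (G y) i).trans ((G.norm_coe_le_norm y).trans hGB)
  · simp only [mul_smul]
    rw [← Finset.smul_sum, ← smul_sub, fiberSeminorm_smul]
    by_cases hyK : y ∈ K
    · refine mul_eq_zero_of_right _ ?_
      rw [fiberSeminorm_eq_norm_mk, map_sub, map_sum, ← hc ⟨y, hyK, hy⟩,
        fiberSeminorm_eq_norm_mk, map_sub, map_sum]
      simp only [mkQ_fiberKernel_smul, map_smul, ContinuousMap.coe_mk, ← hGc]
    · refine mul_eq_zero_of_left ?_ _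
      simpa [ofRealCM] using hu0 fun h => hyK (interior_subset h)

end LocalFrame

/-- The ideals of `C(X, ℂ)` have approximate units for their elements. -/
theorem exists_mem_norm_mul_sub_le {X : Type*} [TopologicalSpace X] [CompactSpace X]
    (J : Ideal C(X, ℂ)) {h : C(X, ℂ)} (hh : h ∈ J) {δ : ℝ} (hδ : 0 < δ) :
    ∃ u ∈ J, ‖u‖ ≤ 1 ∧ ‖u * h - h‖ ≤ δ := by
  have hpos : ∀ x, 0 < ‖h x‖ ^ 2 + δ ^ 2 := fun x => by positivity
  let v : C(X, ℝ) := ⟨fun x => (‖h x‖ ^ 2 + δ ^ 2)⁻¹,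
    (by fun_prop : Continuous fun x => ‖h x‖ ^ 2 + δ ^ 2).inv₀ fun x => (hpos x).ne'⟩
  have hu : ∀ x, (ofRealCM v * star h * h) x =
      ((‖h x‖ ^ 2 / (‖h x‖ ^ 2 + δ ^ 2) : ℝ) : ℂ) := fun x => by
    have h1 : star (h x) * h x = ((‖h x‖ ^ 2 : ℝ) : ℂ) := by
      rw [Complex.star_def, ← Complex.normSq_eq_conj_mul_self, Complex.normSq_eq_norm_sq]
    rw [ContinuousMap.mul_apply, ContinuousMap.mul_apply, mul_assoc, ContinuousMap.star_apply, h1,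
      div_eq_inv_mul, Complex.ofReal_mul]
    rfl
  refine ⟨ofRealCM v * star h * h, J.mul_mem_left _ hh,
    (ContinuousMap.norm_le _ zero_le_one).2 fun x => ?_,
    (ContinuousMap.norm_le _ hδ.le).2 fun x => ?_⟩
  · rw [hu, Complex.norm_real, Real.norm_of_nonneg (by positivity)]
    exact div_le_one_of_le₀ (by nlinarith) (hpos x).le
  · have h1 : (ofRealCM v * star h * h * h - h) x =
        ((-(δ ^ 2 / (‖h x‖ ^ 2 + δ ^ 2)) : ℝ) : ℂ) * h x := by
      have h2 : ‖h x‖ ^ 2 / (‖h x‖ ^ 2 + δ ^ 2) - 1 = -(δ ^ 2 / (‖h x‖ ^ 2 + δ ^ 2)) := by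
        field_simp [(hpos x).ne']; ring
      rw [← h2, ContinuousMap.sub_apply, ContinuousMap.mul_apply, hu]
      push_cast
      ring
    rw [h1, norm_mul, Complex.norm_real, norm_neg, Real.norm_of_nonneg (by positivity),
      div_mul_eq_mul_div]
    refine div_le_of_le_mul₀ (hpos x).le hδ.le ?_
    nlinarith [mul_nonneg hδ.le (sq_nonneg (‖h x‖ - δ)), mul_nonneg hδ.le (norm_nonneg (h x)),
      mul_nonneg (mul_nonneg hδ.le hδ.le) (norm_nonneg (h x)), pow_pos hδ 3]

/-- Automatic continuity: a `C(X,ℂ)`-linear map from a topologically finitely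
generated, `C(X)`-convex unital Banach `C(X,ℂ)`-module with continuous fiber
norms into any complex Banach space `E` equipped with a (not necessarily
unital) contractive `C(X,ℂ)`-action `σ` is continuous. -/
theorem stmt1 {X M E : Type*} [TopologicalSpace X] [CompactSpace X] [T2Space X]
    [NormedAddCommGroup M] [CompleteSpace M] [NormedSpace ℂ M]
    [Module C(X, ℂ) M] [IsScalarTower ℂ C(X, ℂ) M]
    (hnorm : ∀ (f : C(X, ℂ)) (m : M), ‖f • m‖ ≤ ‖f‖ * ‖m‖)
    (hconv : ∀ f : C(X, ℝ), (∀ x, f x ∈ Set.Icc (0 : ℝ) 1) →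
      ∀ m m' : M, ‖ofRealCM f • m + (1 - ofRealCM f) • m'‖ ≤ max ‖m‖ ‖m'‖)
    (hfib : ∀ m : M, Continuous fun x : X =>
      Metric.infDist m ((IY {x} • (⊤ : Submodule C(X, ℂ) M) : Submodule C(X, ℂ) M) : Set M))
    (htfg : ∃ s : Finset M,
      Dense ((Submodule.span C(X, ℂ) (s : Set M) : Submodule C(X, ℂ) M) : Set M))
    [NormedAddCommGroup E] [CompleteSpace E] [NormedSpace ℂ E]
    (σ : C(X, ℂ) → E → E)
    (hσ_addl : ∀ (f g : C(X, ℂ)) (e : E), σ (f + g) e = σ f e + σ g e)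
    (hσ_addr : ∀ (f : C(X, ℂ)) (e e' : E), σ f (e + e') = σ f e + σ f e')
    (hσ_smul : ∀ (c : ℂ) (f : C(X, ℂ)) (e : E), σ (c • f) e = c • σ f e)
    (hσ_mul : ∀ (f g : C(X, ℂ)) (e : E), σ (f * g) e = σ f (σ g e))
    (hσ_norm : ∀ (f : C(X, ℂ)) (e : E), ‖σ f e‖ ≤ ‖f‖ * ‖e‖)
    (T : M → E)
    (hT_add : ∀ m m' : M, T (m + m') = T m + T m')
    (hT_smul : ∀ (f : C(X, ℂ)) (m : M), T (f • m) = σ f (T m)) :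
    Continuous T := by
  have hσ_sub : ∀ (f : C(X, ℂ)) (e e' : E), σ f (e - e') = σ f e - σ f e' := fun f =>
    map_sub (AddMonoidHom.mk' (σ f) (hσ_addr f))
  have hσ_subl : ∀ (f g : C(X, ℂ)) (e : E), σ (f - g) e = σ f e - σ g e := fun f g e =>
    map_sub (AddMonoidHom.mk' (fun f => σ f e) (fun f g => hσ_addl f g e)) f g
  have hσ_zero : ∀ f : C(X, ℂ), σ f 0 = 0 := fun f =>
    map_zero (AddMonoidHom.mk' (σ f) (hσ_addr f))
  have hσ_zerol : ∀ e : E, σ 0 e = 0 := fun e =>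
    map_zero (AddMonoidHom.mk' (fun f => σ f e) (fun f g => hσ_addl f g e))
  have hT_sub : ∀ m m' : M, T (m - m') = T m - T m' := map_sub (AddMonoidHom.mk' T hT_add)
  have hσ_cont : ∀ f : C(X, ℂ), Continuous (σ f) := fun f =>
    AddMonoidHomClass.continuous_of_bound (AddMonoidHom.mk' (σ f) (hσ_addr f)) ‖f‖ (hσ_norm f)
  have hσ_contl : ∀ e : E, Continuous fun f : C(X, ℂ) => σ f e := fun e =>
    AddMonoidHomClass.continuous_of_bound
      (AddMonoidHom.mk' (fun f => σ f e) (fun f g => hσ_addl f g e)) ‖e‖ fun f =>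
        (hσ_norm f e).trans_eq (mul_comm _ _)
  have hσ_one : ∀ m : M, σ 1 (T m) = T m := fun m => by rw [← hT_smul, one_smul]
  have hfib' : ∀ m : M, Continuous fun x : X => fiberSeminorm M x m := fun m => by
    simpa only [fiberSeminorm_apply] using hfib m
  let TL : M →ₗ[ℂ] E :=
    { toFun := T
      map_add' := hT_add
      map_smul' := fun c m => by
        rw [RingHom.id_apply, ← one_smul C(X, ℂ) m, ← smul_assoc, hT_smul, hσ_smul, hσ_one,
          one_smul] }
  refine TL.continuous_of_seq_closed_graph fun v a b hv hTv => ?_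
  let m : ℕ → M := fun j => v j - a
  have hm : Tendsto m atTop (𝓝 0) := by simpa [m] using hv.sub_const a
  let e : E := b - T a
  have hTm : Tendsto (fun j => T (m j)) atTop (𝓝 e) := by
    simpa only [m, hT_sub] using! hTv.sub_const (T a)
  suffices he : e = 0 from sub_eq_zero.1 he
  have hσe : σ 1 e = e := by
    refine tendsto_nhds_unique (((hσ_cont 1).tendsto e).comp hTm) ?_
    simpa only [Function.comp_def, hσ_one] using hTm
  let J : Ideal C(X, ℂ) :=
    { carrier := {f | σ f e = 0}
      add_mem' := fun {f g} (hf : σ f e = 0) (hg : σ g e = 0) => by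
        change σ (f + g) e = 0
        rw [hσ_addl, hf, hg, add_zero]
      zero_mem' := hσ_zerol e
      smul_mem' := fun c f (hf : σ f e = 0) => by
        change σ (c * f) e = 0
        rw [hσ_mul, hf, hσ_zero] }
  have hJ : IsClosed (J : Set C(X, ℂ)) := isClosed_singleton.preimage (hσ_contl e)
  have mem_J : ∀ {f : C(X, ℂ)}, f ∈ J ↔ σ f e = 0 := Iff.rfl
  set Z : Set X := (ContinuousMap.setOfIdeal J)ᶜ
  have hZ : IsClosed Z := (ContinuousMap.setOfIdeal_open J).isClosed_compl
  have hJZ : ∀ f : C(X, ℂ), (∀ x ∈ Z, f x = 0) → f ∈ J := fun f hf => by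
    rw [← ContinuousMap.idealOfSet_ofIdeal_isClosed hJ]
    exact ContinuousMap.mem_idealOfSet.2 fun x hx => hf x hx
  rcases Z.eq_empty_or_nonempty with hZe | ⟨x₀, hx₀⟩
  · rw [← hσe]
    exact hJZ 1 (by simp [hZe])
  exfalso
  obtain ⟨s, hs⟩ := htfg
  classical
  obtain ⟨t, ht⟩ := (s.powerset.filter fun t : Finset M => ∃ x ∈ Z,
      LinearIndepOn ℂ (fiberKernel M x).mkQ (t : Set M)).exists_maximal
    ⟨∅, by simpa using ⟨x₀, hx₀⟩⟩
  have htmem := ht.prop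
  rw [Finset.mem_filter, Finset.mem_powerset] at htmem
  obtain ⟨hts, x, hx, htx⟩ := htmem
  obtain ⟨f, B, hfx, hf⟩ := exists_local_coordinates hfib' hZ htx fun y hy hty =>
    exists_fiberSeminorm_sub_sum_eq_zero hs fun a ha => by
      by_contra hspan
      obtain ⟨hins, hat⟩ := hty.notMem_span_iff.1 hspan
      refine hat (ht.le_of_ge (y := insert a t) ?_ (Finset.subset_insert a t)
        (Finset.mem_insert_self a t))
      rw [Finset.mem_filter, Finset.mem_powerset]
      exact ⟨Finset.insert_subset ha hts, y, hy, by rwa [Finset.coe_insert]⟩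
  suffices hfJ : f ∈ J by
    have := ContinuousMap.notMem_setOfIdeal.1 hx hfJ
    exact one_ne_zero (hfx.symm.trans this)
  have hJf : ∀ u ∈ J, σ u (σ f e) = 0 := fun u hu => by
    rw [← hσ_mul, mul_comm, hσ_mul, mem_J.1 hu, hσ_zero]
  rw [mem_J, ← norm_le_zero_iff]
  refine le_of_forall_pos_le_add fun ε hε => ?_
  rw [zero_add]
  have hlim : Tendsto (fun j => T (f • m j)) atTop (𝓝 (σ f e)) := by
    simpa only [hT_smul, Function.comp_def] using ((hσ_cont f).tendsto e).comp hTm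
  have hsmall : Tendsto (fun j => B * ‖m j‖ * ∑ i : t, ‖T i‖) atTop (𝓝 0) := by
    simpa using (hm.norm.const_mul B).mul_const (∑ i : t, ‖T i‖)
  obtain ⟨j, hj₁, hj₂⟩ := ((Metric.tendsto_nhds.1 hlim (ε / 5) (by positivity)).and
    (hsmall.eventually_lt_const (show 0 < ε / 5 by positivity))).exists
  obtain ⟨g, hgB, hgZ⟩ := hf (m j)
  obtain ⟨h, r, hr, hh⟩ := exists_eq_smul_of_fiberSeminorm_eq_zero hnorm hconv
    (hfib' (f • m j - ∑ i, g i • (i : M)))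
  have hhJ : h ∈ J := hJZ h fun y hy => hh y (hgZ y hy)
  have hT_sum : T (∑ i, g i • (i : M)) = ∑ i, σ (g i) (T i) :=
    (map_sum (AddMonoidHom.mk' T hT_add) _ _).trans (Finset.sum_congr rfl fun i _ => hT_smul _ _)
  have hsum : ‖∑ i, σ (g i) (T i)‖ < ε / 5 := by
    refine ((norm_sum_le _ _).trans ?_).trans_lt hj₂
    rw [Finset.mul_sum]
    exact Finset.sum_le_sum fun i _ => (hσ_norm _ _).trans (by gcongr; exact hgB i)
  have hTr : T (f • m j) = σ h (T r) + ∑ i, σ (g i) (T i) := by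
    rw [← hT_sum, ← hT_smul, ← hr, ← hT_add, sub_add_cancel]
  have hclose : ‖σ f e - σ h (T r)‖ ≤ 2 * (ε / 5) := by
    have h1 : σ f e - σ h (T r) = (σ f e - T (f • m j)) + ∑ i, σ (g i) (T i) := by
      rw [hTr]; abel
    rw [dist_comm, dist_eq_norm] at hj₁
    rw [h1]
    linarith [norm_add_le (σ f e - T (f • m j)) (∑ i, σ (g i) (T i))]
  obtain ⟨u, huJ, hu1, huh⟩ := exists_mem_norm_mul_sub_le J hhJ
    (show 0 < ε / 5 / (‖T r‖ + 1) by positivity)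
  have h1 : ‖σ u (σ f e - σ h (T r))‖ ≤ 2 * (ε / 5) :=
    (hσ_norm _ _).trans ((mul_le_of_le_one_left (norm_nonneg _) hu1).trans hclose)
  have h2 : ‖σ (u * h - h) (T r)‖ ≤ ε / 5 := by
    refine (hσ_norm _ _).trans ?_
    calc ‖u * h - h‖ * ‖T r‖ ≤ ε / 5 / (‖T r‖ + 1) * (‖T r‖ + 1) := by
          gcongr; linarith
      _ = ε / 5 := by field_simp
  have h3 : σ f e = (σ f e - σ h (T r)) - σ u (σ f e - σ h (T r)) - σ (u * h - h) (T r) := by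
    rw [hσ_sub u (σ f e), hσ_subl, hσ_mul, hJf u huJ]
    abel
  rw [h3]
  refine (norm_sub_le _ _).trans ?_
  linarith [norm_sub_le (σ f e - σ h (T r)) (σ u (σ f e - σ h (T r)))]
end

section
/- Let X be a compact Hausdorff space with a finite closed cover X = X_1 ∪ ⋯ ∪ X_n and let M be a unital Banach C(X,ℂ)-module. Then for every m ∈ M one has ‖m‖ ≤ n · max_{1 ≤ i ≤ n} dist(m, I_{X_i} • M), where dist denotes the infimum of distances from m to elements of the submodule I_{X_i} • M. -/
/-- An element of `I_Y • M` is almost annihilated by every contraction supported in a suitable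
neighbourhood of `Y`. -/
theorem exists_isOpen_norm_smul_le_of_mem_IY_smul {X M : Type*} [TopologicalSpace X]
    [CompactSpace X] [NormedAddCommGroup M] [Module C(X, ℂ) M]
    (hnorm : ∀ (f : C(X, ℂ)) (m : M), ‖f • m‖ ≤ ‖f‖ * ‖m‖) {Y : Set X} {x : M}
    (hx : x ∈ IY Y • (⊤ : Submodule C(X, ℂ) M)) {ε : ℝ} (hε : 0 < ε) :
    ∃ U : Set X, IsOpen U ∧ Y ⊆ U ∧
      ∀ φ : C(X, ℂ), ‖φ‖ ≤ 1 → (∀ y, y ∉ U → φ y = 0) → ‖φ • x‖ ≤ ε := by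
  induction hx using Submodule.smul_induction_on' generalizing ε with
  | smul f hf m _ =>
    have hδ : 0 < ε / (‖m‖ + 1) := by positivity
    refine ⟨{y | ‖f y‖ < ε / (‖m‖ + 1)}, isOpen_lt (by fun_prop) continuous_const,
      fun y hy => ?_, fun φ hφ hsupp => ?_⟩
    · have hfy : f y = 0 := hf y hy
      simpa [hfy] using hδ
    · have hφf : ‖φ * f‖ ≤ ε / (‖m‖ + 1) := by
        refine (ContinuousMap.norm_le _ hδ.le).mpr fun y => ?_
        by_cases hy : ‖f y‖ < ε / (‖m‖ + 1)
        · rw [ContinuousMap.mul_apply, norm_mul]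
          calc ‖φ y‖ * ‖f y‖ ≤ 1 * ‖f y‖ := by
                gcongr
                exact (φ.norm_coe_le_norm y).trans hφ
            _ ≤ ε / (‖m‖ + 1) := by rw [one_mul]; exact hy.le
        · rw [ContinuousMap.mul_apply, hsupp y hy, zero_mul, norm_zero]
          exact hδ.le
      rw [smul_smul]
      calc ‖(φ * f) • m‖ ≤ ‖φ * f‖ * ‖m‖ := hnorm _ _
        _ ≤ ε / (‖m‖ + 1) * (‖m‖ + 1) := by gcongr; linarith
        _ = ε := div_mul_cancel₀ _ (by positivity)
  | add a _ b _ iha ihb =>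
    obtain ⟨U, hU, hYU, ha⟩ := iha (half_pos hε)
    obtain ⟨V, hV, hYV, hb⟩ := ihb (half_pos hε)
    refine ⟨U ∩ V, hU.inter hV, Set.subset_inter hYU hYV, fun φ hφ hsupp => ?_⟩
    rw [smul_add]
    have hφa := ha φ hφ fun y hy => hsupp y fun h => hy h.1
    have hφb := hb φ hφ fun y hy => hsupp y fun h => hy h.2
    linarith [norm_add_le (φ • a) (φ • b)]

/-- A finite open cover of a compact Hausdorff space admits a subordinate partition of unity by
complex-valued contractions. -/
theorem exists_complex_partition_of_unity {X ι : Type*} [TopologicalSpace X] [CompactSpace X]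
    [T2Space X] [Fintype ι] {U : ι → Set X} (hU : ∀ i, IsOpen (U i))
    (hcov : ⋃ i, U i = Set.univ) :
    ∃ φ : ι → C(X, ℂ), ∑ i, φ i = 1 ∧ (∀ i, ‖φ i‖ ≤ 1) ∧ ∀ i, ∀ y, y ∉ U i → φ i y = 0 := by
  obtain ⟨p, hp⟩ := PartitionOfUnity.exists_isSubordinate_of_locallyFinite
    isClosed_univ U hU (locallyFinite_of_finite U) hcov.ge
  refine ⟨fun i => ⟨fun y => (p i y : ℂ), by fun_prop⟩, ?_, fun i => ?_, fun i y hy => ?_⟩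
  · ext y
    have hsum := p.sum_eq_one (Set.mem_univ y)
    rw [finsum_eq_sum_of_fintype] at hsum
    simp only [ContinuousMap.sum_apply, ContinuousMap.coe_mk, ContinuousMap.one_apply]
    exact_mod_cast hsum
  · refine (ContinuousMap.norm_le _ zero_le_one).mpr fun y => ?_
    simpa [abs_of_nonneg (p.nonneg i y)] using p.le_one i y
  · have hpy : p i y = 0 := by
      by_contra h
      exact hy (hp i (subset_tsupport _ h))
    simp [hpy]

/-- For a finite closed cover `X = X_1 ∪ ⋯ ∪ X_n` of a compact Hausdorff space
and a unital Banach `C(X,ℂ)`-module `M`,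
`‖m‖ ≤ n · max_i dist(m, I_{X_i} • M)` for every `m ∈ M`. -/
theorem stmt2 {X M : Type*} [TopologicalSpace X] [CompactSpace X] [T2Space X]
    [NormedAddCommGroup M] [CompleteSpace M] [Module C(X, ℂ) M]
    (hnorm : ∀ (f : C(X, ℂ)) (m : M), ‖f • m‖ ≤ ‖f‖ * ‖m‖)
    (n : ℕ) (hn : 0 < n) (Xi : Fin n → Set X)
    (hcl : ∀ i, IsClosed (Xi i)) (hcov : ⋃ i, Xi i = Set.univ) (m : M) :
    ‖m‖ ≤ n * Finset.univ.sup'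
      (Finset.univ_nonempty_iff.mpr (Fin.pos_iff_nonempty.mp hn))
      (fun i => Metric.infDist m
        ((IY (Xi i) • (⊤ : Submodule C(X, ℂ) M) : Submodule C(X, ℂ) M) : Set M)) := by
  set d : Fin n → ℝ := fun i => Metric.infDist m
    ((IY (Xi i) • (⊤ : Submodule C(X, ℂ) M) : Submodule C(X, ℂ) M) : Set M)
  set D := Finset.univ.sup' (Finset.univ_nonempty_iff.mpr (Fin.pos_iff_nonempty.mp hn)) d
  have hn' : (0 : ℝ) < n := Nat.cast_pos.mpr hn
  refine le_of_forall_pos_le_add fun ε hε => ?_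
  have hδ : 0 < ε / n / 2 := by positivity
  have happrox (i : Fin n) : ∃ x ∈ IY (Xi i) • (⊤ : Submodule C(X, ℂ) M),
      dist m x < d i + ε / n / 2 :=
    (Metric.infDist_lt_iff ⟨0, Submodule.zero_mem _⟩).mp (lt_add_of_pos_right _ hδ)
  choose x hx hdist using happrox
  choose U hU hXU hsmall using fun i =>
    exists_isOpen_norm_smul_le_of_mem_IY_smul hnorm (hx i) hδ
  obtain ⟨φ, hsum, hφ, hsupp⟩ := exists_complex_partition_of_unity hU
    (Set.univ_subset_iff.mp (hcov ▸ Set.iUnion_mono hXU))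
  have hterm (i : Fin n) : ‖φ i • m‖ ≤ D + ε / n := by
    have hφx := hsmall i (φ i) (hφ i) (hsupp i)
    have hφmx : ‖φ i • (m - x i)‖ ≤ ‖m - x i‖ :=
      (hnorm _ _).trans (mul_le_of_le_one_left (norm_nonneg _) (hφ i))
    have hdD : d i ≤ D := Finset.le_sup' d (Finset.mem_univ i)
    have hmx := hdist i
    rw [dist_eq_norm] at hmx
    have htri := norm_add_le (φ i • (m - x i)) (φ i • x i)
    rw [← smul_add, sub_add_cancel] at htri
    linarith
  calc ‖m‖ = ‖∑ i, φ i • m‖ := by rw [← Finset.sum_smul, hsum, one_smul]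
    _ ≤ ∑ i, ‖φ i • m‖ := norm_sum_le _ _
    _ ≤ ∑ _i : Fin n, (D + ε / n) := Finset.sum_le_sum fun i _ => hterm i
    _ = n * D + ε := by
      rw [Finset.sum_const, Finset.card_univ, Fintype.card_fin, nsmul_eq_mul]
      field_simp
end

section
/- Let X be a compact Hausdorff space with a finite closed cover X = X_1 ∪ ⋯ ∪ X_n and let M be a unital Banach C(X,ℂ)-module. Then the intersection of the topological closures of the submodules I_{X_i} • M, for i = 1, …, n, is the zero submodule; equivalently, the canonical C(X,ℂ)-linear map from M to the product of the quotient modules M / closure(I_{X_i} • M) is injective. -/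
/-- A continuous function `f` is made small by a contraction equal to `1` on the zeros of `f`. -/
lemma exists_norm_mul_le_eq_one_of_eq_zero {X : Type*} [TopologicalSpace X] [CompactSpace X]
    (f : C(X, ℂ)) {δ : ℝ} (hδ : 0 < δ) :
    ∃ u : C(X, ℂ), ‖u‖ ≤ 1 ∧ (∀ x, f x = 0 → u x = 1) ∧ ‖u * f‖ ≤ δ := by
  have hpos : ∀ x, 0 < δ + ‖f x‖ := fun x => by positivity
  let r : C(X, ℝ) := ⟨fun x => δ / (δ + ‖f x‖),
    continuous_const.div (by fun_prop) fun x => (hpos x).ne'⟩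
  let u : C(X, ℂ) := ⟨fun x => (r x : ℂ), by fun_prop⟩
  have hr : ∀ x, r x = δ / (δ + ‖f x‖) := fun _ => rfl
  have hu : ∀ x, ‖u x‖ = δ / (δ + ‖f x‖) := fun x => by
    change ‖(r x : ℂ)‖ = _
    rw [Complex.norm_real, hr, Real.norm_of_nonneg (div_nonneg hδ.le (hpos x).le)]
  refine ⟨u, ?_, fun x hx => ?_, ?_⟩
  · refine (ContinuousMap.norm_le _ zero_le_one).2 fun x => ?_
    rw [hu, div_le_one (hpos x)]
    linarith [norm_nonneg (f x)]
  · change (r x : ℂ) = 1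
    rw [hr, hx, norm_zero, add_zero, div_self hδ.ne', Complex.ofReal_one]
  · refine (ContinuousMap.norm_le _ hδ.le).2 fun x => ?_
    rw [ContinuousMap.mul_apply, norm_mul, hu, div_mul_eq_mul_div, div_le_iff₀ (hpos x)]
    nlinarith [norm_nonneg (f x)]

section BanachModule

variable {X M : Type*} [TopologicalSpace X] [CompactSpace X]
  [NormedAddCommGroup M] [Module C(X, ℂ) M]

/-- Elements of `I_Y • M` are made arbitrarily small by contractions equal to `1` on `Y`. -/
lemma exists_norm_smul_le_of_mem_IY_smul
    (hnorm : ∀ (f : C(X, ℂ)) (m : M), ‖f • m‖ ≤ ‖f‖ * ‖m‖) {Y : Set X} {m : M}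
    (hm : m ∈ (IY Y • (⊤ : Submodule C(X, ℂ) M) : Submodule C(X, ℂ) M)) :
    ∀ ε > 0, ∃ u : C(X, ℂ), ‖u‖ ≤ 1 ∧ (∀ y ∈ Y, u y = 1) ∧ ‖u • m‖ ≤ ε := by
  induction hm using Submodule.smul_induction_on' with
  | smul f hf a _ =>
    intro ε hε
    obtain ⟨u, hu, hu_one, huf⟩ :=
      exists_norm_mul_le_eq_one_of_eq_zero f (δ := ε / (‖a‖ + 1)) (by positivity)
    refine ⟨u, hu, fun y hy => hu_one y (hf y hy), ?_⟩
    calc ‖u • f • a‖ = ‖(u * f) • a‖ := by rw [mul_smul]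
      _ ≤ ‖u * f‖ * ‖a‖ := hnorm _ _
      _ ≤ ε / (‖a‖ + 1) * (‖a‖ + 1) := by gcongr; linarith
      _ = ε := div_mul_cancel₀ _ (by positivity)
  | add a _ b _ iha ihb =>
    intro ε hε
    obtain ⟨u, hu, hu_one, hua⟩ := iha (ε / 2) (by positivity)
    obtain ⟨v, hv, hv_one, hvb⟩ := ihb (ε / 2) (by positivity)
    refine ⟨u * v, (norm_mul_le _ _).trans (mul_le_one₀ hu (norm_nonneg _) hv),
      fun y hy => by simp [hu_one y hy, hv_one y hy], ?_⟩
    have ha : ‖v • u • a‖ ≤ ε / 2 :=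
      (hnorm _ _).trans ((mul_le_of_le_one_left (norm_nonneg _) hv).trans hua)
    have hb : ‖u • v • b‖ ≤ ε / 2 :=
      (hnorm _ _).trans ((mul_le_of_le_one_left (norm_nonneg _) hu).trans hvb)
    calc ‖(u * v) • (a + b)‖ = ‖v • u • a + u • v • b‖ := by
          rw [smul_add, mul_smul u v b, mul_comm, mul_smul]
      _ ≤ ε := (norm_add_le _ _).trans (by linarith)

/-- Elements of the closure of `I_Y • M` are made arbitrarily small by contractions equal to `1`
on `Y`. -/
lemma exists_norm_smul_le_of_mem_closure_IY_smul
    (hnorm : ∀ (f : C(X, ℂ)) (m : M), ‖f • m‖ ≤ ‖f‖ * ‖m‖) {Y : Set X} {m : M}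
    (hm : m ∈ closure ((IY Y • (⊤ : Submodule C(X, ℂ) M) : Submodule C(X, ℂ) M) : Set M))
    {ε : ℝ} (hε : 0 < ε) :
    ∃ u : C(X, ℂ), ‖u‖ ≤ 1 ∧ (∀ y ∈ Y, u y = 1) ∧ ‖u • m‖ ≤ ε := by
  obtain ⟨a, ha, hma⟩ := Metric.mem_closure_iff.1 hm (ε / 2) (by positivity)
  obtain ⟨u, hu, hu_one, hua⟩ :=
    exists_norm_smul_le_of_mem_IY_smul hnorm ha (ε / 2) (by positivity)
  refine ⟨u, hu, hu_one, ?_⟩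
  rw [dist_eq_norm] at hma
  have hsub : ‖u • (m - a)‖ ≤ ‖m - a‖ :=
    (hnorm _ _).trans (mul_le_of_le_one_left (norm_nonneg _) hu)
  calc ‖u • m‖ = ‖u • (m - a) + u • a‖ := by rw [← smul_add, sub_add_cancel]
    _ ≤ ε := (norm_add_le _ _).trans (by linarith)

/-- An element of the closures of finitely many `I_{Y i} • M` is made arbitrarily small by
functions equal to `1` on the union of the `Y i`. -/
lemma exists_norm_smul_le_of_forall_mem_closure_IY_smul
    (hnorm : ∀ (f : C(X, ℂ)) (m : M), ‖f • m‖ ≤ ‖f‖ * ‖m‖) {ι : Type*} (Y : ι → Set X)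
    (s : Finset ι) {m : M}
    (hm : ∀ i ∈ s,
      m ∈ closure ((IY (Y i) • (⊤ : Submodule C(X, ℂ) M) : Submodule C(X, ℂ) M) : Set M)) :
    ∀ ε > 0, ∃ v : C(X, ℂ), (∀ i ∈ s, ∀ y ∈ Y i, v y = 1) ∧ ‖v • m‖ ≤ ε := by
  classical
  induction s using Finset.induction_on with
  | empty => exact fun ε hε => ⟨0, by simp, by simpa using hε.le⟩
  | insert i s _ ih =>
    intro ε hε
    obtain ⟨v, hv_one, hvm⟩ :=
      ih (fun j hj => hm j (Finset.mem_insert_of_mem hj)) (ε / 3) (by positivity)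
    obtain ⟨u, hu, hu_one, hum⟩ := exists_norm_smul_le_of_mem_closure_IY_smul hnorm
      (hm i (Finset.mem_insert_self i s)) (ε := ε / 3) (by positivity)
    refine ⟨u + v - u * v, fun j hj y hy => ?_, ?_⟩
    · rcases Finset.mem_insert.1 hj with rfl | hj
      · simp [hu_one y hy]
      · simp [hv_one j hj y hy]
    · have huv : ‖u • v • m‖ ≤ ε / 3 :=
        (hnorm _ _).trans ((mul_le_of_le_one_left (norm_nonneg _) hu).trans hvm)
      rw [sub_smul, add_smul, mul_smul]
      linarith [norm_sub_le (u • m + v • m) (u • v • m), norm_add_le (u • m) (v • m)]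

end BanachModule

/-- For a finite closed cover `X = X_1 ∪ ⋯ ∪ X_n` of a compact Hausdorff space
and a unital Banach `C(X,ℂ)`-module `M`, the intersection of the closures of
the submodules `I_{X_i} • M` is zero; equivalently, the canonical map from `M`
to the product of the quotients `M / closure(I_{X_i} • M)` is injective. -/
theorem stmt3 {X M : Type*} [TopologicalSpace X] [CompactSpace X] [T2Space X]
    [NormedAddCommGroup M] [CompleteSpace M] [Module C(X, ℂ) M]
    (hnorm : ∀ (f : C(X, ℂ)) (m : M), ‖f • m‖ ≤ ‖f‖ * ‖m‖)
    (n : ℕ) (hn : 0 < n) (Xi : Fin n → Set X)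
    (hcl : ∀ i, IsClosed (Xi i)) (hcov : ⋃ i, Xi i = Set.univ) :
    ⋂ i, closure ((IY (Xi i) • (⊤ : Submodule C(X, ℂ) M) : Submodule C(X, ℂ) M) : Set M)
      = {0} := by
  refine Set.Subset.antisymm (fun m hm => ?_) ?_
  · rw [Set.mem_singleton_iff, ← norm_le_zero_iff]
    refine le_of_forall_pos_le_add fun ε hε => ?_
    obtain ⟨v, hv_one, hvm⟩ := exists_norm_smul_le_of_forall_mem_closure_IY_smul hnorm Xi
      Finset.univ (fun i _ => Set.mem_iInter.1 hm i) ε hε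
    have hv : v = 1 := by
      ext x
      obtain ⟨i, hi⟩ := Set.mem_iUnion.1 (hcov ▸ Set.mem_univ x)
      exact hv_one i (Finset.mem_univ i) x hi
    simpa [hv] using hvm
  · rw [Set.singleton_subset_iff, Set.mem_iInter]
    exact fun i => subset_closure (Submodule.zero_mem _)
end

section
/- Let X be a compact Hausdorff space with a finite closed cover X = X_1 ∪ ⋯ ∪ X_n and let M be a unital Banach C(X,ℂ)-module. Given elements m_1, …, m_n ∈ M such that m_i − m_j lies in the topological closure of I_{X_i ∩ X_j} • M for all i, j, there exists m ∈ M such that m − m_i lies in the topological closure of I_{X_i} • M for every i. -/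
section Gluing

variable {X M : Type*} [TopologicalSpace X]

theorem IY_antitone {Y Z : Set X} (h : Y ⊆ Z) : IY Z ≤ IY Y :=
  fun _ hf y hy => hf y (h hy)

theorem one_sub_mem_IY {Y : Set X} {e : C(X, ℂ)} (he : ∀ y ∈ Y, e y = 1) : 1 - e ∈ IY Y :=
  fun y hy => by simp [he y hy]

theorem mul_mem_IY_union {Y Z : Set X} {f g : C(X, ℂ)} (hf : f ∈ IY Y) (hg : g ∈ IY Z) :
    f * g ∈ IY (Y ∪ Z) := by
  rintro y (hy | hy)
  · simp [hf y hy]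
  · simp [hg y hy]

/-- A norm-controlled decomposition of the ideal of `A ∩ B` as the sum of those of `A` and `B`. -/
theorem exists_add_mem_IY [CompactSpace X] [T2Space X] {A B : Set X} (hA : IsClosed A)
    (hB : IsClosed B) {u : C(X, ℂ)} (hu : u ∈ IY (A ∩ B)) (hu2 : ‖u‖ ≤ 2) :
    ∃ g ∈ IY A, ∃ h ∈ IY B, g + h = u ∧ ‖g‖ ≤ 4 ∧ ‖h‖ ≤ 4 := by
  classical
  have hc : ContinuousOn (A.indicator u) (A ∪ B) := by
    refine ContinuousOn.union_of_isClosed ?_ ?_ hA hB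
    · exact u.continuous.continuousOn.congr fun x hx => Set.indicator_of_mem hx _
    · refine (continuousOn_const (c := (0 : ℂ))).congr fun x hx => ?_
      by_cases hxA : x ∈ A
      · rw [Set.indicator_of_mem hxA, hu x ⟨hxA, hx⟩]
      · exact Set.indicator_of_notMem hxA _
  have : TietzeExtension (Metric.closedBall (0 : ℂ) 2) :=
    Metric.instTietzeExtensionClosedBall ℂ (0 : ℂ) (by norm_num)
  obtain ⟨h, hmem, hres⟩ := ContinuousMap.exists_forall_mem_restrict_eq (hA.union hB)
    (⟨(A ∪ B).domRestrict (A.indicator u), hc.domRestrict⟩ : C(↥(A ∪ B), ℂ))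
    (t := Metric.closedBall (0 : ℂ) 2) (fun x => by
      simpa using (norm_indicator_le_norm_self u (x : X)).trans ((u.norm_coe_le_norm _).trans hu2))
  have hval : ∀ x ∈ A ∪ B, h x = A.indicator u x := fun x hx =>
    DFunLike.congr_fun hres ⟨x, hx⟩
  have hn : ‖h‖ ≤ 2 := (ContinuousMap.norm_le _ (by norm_num)).2 fun x => by
    simpa using hmem x
  refine ⟨u - h, fun x hx => ?_, h, fun x hx => ?_, sub_add_cancel _ _, ?_, by linarith⟩
  · simp [hval x (Or.inl hx), hx]
  · rw [hval x (Or.inr hx)]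
    by_cases hxA : x ∈ A
    · rw [Set.indicator_of_mem hxA, hu x ⟨hxA, hx⟩]
    · exact Set.indicator_of_notMem hxA _
  · linarith [norm_sub_le u h]

/-- An element of norm at most one which is `1` on the zero set of `f` and almost kills `f`. -/
theorem exists_norm_mul_le [CompactSpace X] (f : C(X, ℂ)) {ε : ℝ} (hε : 0 < ε) :
    ∃ e : C(X, ℂ), ‖e‖ ≤ 1 ∧ (∀ x, f x = 0 → e x = 1) ∧ ‖e * f‖ ≤ ε := by
  have hpos : ∀ x, 0 < ε + ‖f x‖ := fun x => by positivity
  refine ⟨⟨fun x => ((ε / (ε + ‖f x‖) : ℝ) : ℂ), ?_⟩, ?_, ?_, ?_⟩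
  · exact Complex.continuous_ofReal.comp (continuous_const.div (by fun_prop) fun x => (hpos x).ne')
  · refine (ContinuousMap.norm_le _ zero_le_one).2 fun x => ?_
    rw [ContinuousMap.coe_mk, Complex.norm_real, Real.norm_of_nonneg (by positivity),
      div_le_one (hpos x)]
    linarith [norm_nonneg (f x)]
  · intro x hx
    simp [hx, hε.ne']
  · refine (ContinuousMap.norm_le _ hε.le).2 fun x => ?_
    rw [ContinuousMap.mul_apply, norm_mul, ContinuousMap.coe_mk, Complex.norm_real,
      Real.norm_of_nonneg (by positivity), div_mul_eq_mul_div, div_le_iff₀ (hpos x)]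
    nlinarith [norm_nonneg (f x)]

variable [NormedAddCommGroup M] [Module C(X, ℂ) M]

variable (M) in
/-- The closure of `IY Y • M`, as an additive subgroup of `M`. -/
noncomputable def closureIYSMul (Y : Set X) : AddSubgroup M :=
  (IY Y • (⊤ : Submodule C(X, ℂ) M)).toAddSubgroup.topologicalClosure

theorem mem_closureIYSMul {Y : Set X} {w : M} : w ∈ closureIYSMul M Y ↔
    w ∈ closure ((IY Y • (⊤ : Submodule C(X, ℂ) M) : Submodule C(X, ℂ) M) : Set M) :=
  Iff.rfl

theorem closureIYSMul_antitone {Y Z : Set X} (h : Y ⊆ Z) :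
    closureIYSMul M Z ≤ closureIYSMul M Y := fun _ hw =>
  closure_mono (SetLike.coe_subset_coe.2 (Submodule.smul_mono_left (IY_antitone h))) hw

theorem smul_mem_closureIYSMul {Y : Set X} {f : C(X, ℂ)} (hf : f ∈ IY Y) (w : M) :
    f • w ∈ closureIYSMul M Y :=
  subset_closure (Submodule.smul_mem_smul hf Submodule.mem_top)

theorem mem_closureIYSMul_of_forall {Y : Set X} {w : M}
    (h : ∀ ε : ℝ, 0 < ε → ∃ u ∈ IY Y, ‖w - u • w‖ < ε) :
    w ∈ closureIYSMul M Y := by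
  refine mem_closureIYSMul.2 (Metric.mem_closure_iff.2 fun ε hε => ?_)
  obtain ⟨u, hu, hlt⟩ := h ε hε
  exact ⟨u • w, Submodule.smul_mem_smul hu Submodule.mem_top, by rwa [dist_eq_norm]⟩

variable [CompactSpace X]

theorem exists_norm_smul_lt (hnorm : ∀ (f : C(X, ℂ)) (m : M), ‖f • m‖ ≤ ‖f‖ * ‖m‖)
    {Y : Set X} {w : M} (hw : w ∈ closureIYSMul M Y) {ε : ℝ} (hε : 0 < ε) :
    ∃ e : C(X, ℂ), ‖e‖ ≤ 1 ∧ (∀ y ∈ Y, e y = 1) ∧ ‖e • w‖ < ε := by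
  have contr : ∀ (e : C(X, ℂ)) (v : M), ‖e‖ ≤ 1 → ‖e • v‖ ≤ ‖v‖ := fun e v he =>
    (hnorm e v).trans (mul_le_of_le_one_left (norm_nonneg v) he)
  have algebraic : ∀ v ∈ IY Y • (⊤ : Submodule C(X, ℂ) M), ∀ ε : ℝ, 0 < ε →
      ∃ e : C(X, ℂ), ‖e‖ ≤ 1 ∧ (∀ y ∈ Y, e y = 1) ∧ ‖e • v‖ < ε := by
    intro v hv
    induction hv using Submodule.smul_induction_on' with
    | smul f hf m _ =>
      intro ε hε
      have hm : 0 < ‖m‖ + 1 := by positivity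
      obtain ⟨e, he, he1, hef⟩ := exists_norm_mul_le f (div_pos hε hm)
      refine ⟨e, he, fun y hy => he1 y (hf y hy), ?_⟩
      rw [smul_smul]
      calc ‖(e * f) • m‖ ≤ ε / (‖m‖ + 1) * ‖m‖ := (hnorm _ _).trans (by gcongr)
        _ < ε / (‖m‖ + 1) * (‖m‖ + 1) := by gcongr; linarith
        _ = ε := div_mul_cancel₀ _ hm.ne'
    | add v₁ _ v₂ _ ih₁ ih₂ =>
      intro ε hε
      obtain ⟨e₁, hn₁, he₁, hs₁⟩ := ih₁ (ε / 2) (half_pos hε)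
      obtain ⟨e₂, hn₂, he₂, hs₂⟩ := ih₂ (ε / 2) (half_pos hε)
      refine ⟨e₁ * e₂, (norm_mul_le _ _).trans (mul_le_one₀ hn₁ (norm_nonneg _) hn₂),
        fun y hy => by simp [he₁ y hy, he₂ y hy], ?_⟩
      have h₁ : ‖(e₁ * e₂) • v₁‖ ≤ ‖e₁ • v₁‖ := by
        rw [mul_comm, mul_smul]
        exact contr _ _ hn₂
      have h₂ : ‖(e₁ * e₂) • v₂‖ ≤ ‖e₂ • v₂‖ := by
        rw [mul_smul]
        exact contr _ _ hn₁
      rw [smul_add]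
      linarith [norm_add_le ((e₁ * e₂) • v₁) ((e₁ * e₂) • v₂)]
  obtain ⟨v, hv, hvw⟩ := Metric.mem_closure_iff.1 (mem_closureIYSMul.1 hw) (ε / 2) (half_pos hε)
  obtain ⟨e, hn, he, hs⟩ := algebraic v hv (ε / 2) (half_pos hε)
  refine ⟨e, hn, he, ?_⟩
  rw [dist_eq_norm] at hvw
  have h₁ := norm_add_le (e • (w - v)) (e • v)
  rw [← smul_add, sub_add_cancel] at h₁
  linarith [contr e (w - v) hn]

theorem mem_closureIYSMul_union (hnorm : ∀ (f : C(X, ℂ)) (m : M), ‖f • m‖ ≤ ‖f‖ * ‖m‖)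
    {Y Z : Set X} {w : M} (hY : w ∈ closureIYSMul M Y) (hZ : w ∈ closureIYSMul M Z) :
    w ∈ closureIYSMul M (Y ∪ Z) := by
  refine mem_closureIYSMul_of_forall fun ε hε => ?_
  obtain ⟨e, hn, he, hs⟩ := exists_norm_smul_lt hnorm hY (half_pos hε)
  obtain ⟨d, hn', hd, hs'⟩ := exists_norm_smul_lt hnorm hZ (half_pos (half_pos hε))
  refine ⟨(1 - e) * (1 - d), mul_mem_IY_union (one_sub_mem_IY he) (one_sub_mem_IY hd), ?_⟩
  have key : w - ((1 - e) * (1 - d)) • w = e • w + (d • w - e • d • w) := by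
    simp only [mul_smul, sub_smul, one_smul, smul_sub]
    abel
  have h₁ : ‖e • d • w‖ ≤ ‖d • w‖ :=
    (hnorm _ _).trans (mul_le_of_le_one_left (norm_nonneg _) hn)
  rw [key]
  linarith [norm_add_le (e • w) (d • w - e • d • w), norm_sub_le (d • w) (e • d • w)]

theorem mem_closureIYSMul_biUnion (hnorm : ∀ (f : C(X, ℂ)) (m : M), ‖f • m‖ ≤ ‖f‖ * ‖m‖)
    {ι : Type*} (s : Finset ι) (Y : ι → Set X) {w : M}
    (h : ∀ i ∈ s, w ∈ closureIYSMul M (Y i)) :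
    w ∈ closureIYSMul M (⋃ i ∈ s, Y i) := by
  classical
  induction s using Finset.induction_on with
  | empty =>
    have := smul_mem_closureIYSMul (Y := (∅ : Set X)) (f := 1) (by intro y hy; exact hy.elim) w
    simpa using this
  | insert j s _ ih =>
    rw [Finset.set_biUnion_insert]
    exact mem_closureIYSMul_union hnorm (h j (Finset.mem_insert_self j s))
      (ih fun i hi => h i (Finset.mem_insert_of_mem hi))

variable [T2Space X]

theorem exists_approx_add (hnorm : ∀ (f : C(X, ℂ)) (m : M), ‖f • m‖ ≤ ‖f‖ * ‖m‖)
    {A B : Set X} (hA : IsClosed A) (hB : IsClosed B) {w : M}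
    (hw : w ∈ closureIYSMul M (A ∩ B)) {ε : ℝ} (hε : 0 < ε) :
    ∃ a ∈ closureIYSMul M A, ∃ b ∈ closureIYSMul M B,
      ‖a‖ ≤ 4 * ‖w‖ ∧ ‖b‖ ≤ 4 * ‖w‖ ∧ ‖w - (a + b)‖ < ε := by
  obtain ⟨e, hn, he, hs⟩ := exists_norm_smul_lt hnorm hw hε
  have hu : ‖1 - e‖ ≤ 2 := by
    refine (ContinuousMap.norm_le _ (by norm_num)).2 fun x => ?_
    have h₁ := norm_sub_le (1 : ℂ) (e x)
    rw [norm_one] at h₁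
    rw [ContinuousMap.sub_apply, ContinuousMap.one_apply]
    linarith [e.norm_coe_le_norm x]
  obtain ⟨g, hg, h, hh, hgh, hgn, hhn⟩ := exists_add_mem_IY hA hB (one_sub_mem_IY he) hu
  refine ⟨g • w, smul_mem_closureIYSMul hg w, h • w, smul_mem_closureIYSMul hh w,
    (hnorm _ _).trans (by gcongr), (hnorm _ _).trans (by gcongr), ?_⟩
  rw [← add_smul, hgh, sub_smul, one_smul, sub_sub_cancel]
  exact hs

theorem exists_add_of_mem_closureIYSMul_inter [CompleteSpace M]
    (hnorm : ∀ (f : C(X, ℂ)) (m : M), ‖f • m‖ ≤ ‖f‖ * ‖m‖)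
    {A B : Set X} (hA : IsClosed A) (hB : IsClosed B) {w : M}
    (hw : w ∈ closureIYSMul M (A ∩ B)) :
    ∃ a ∈ closureIYSMul M A, ∃ b ∈ closureIYSMul M B, a + b = w := by
  have step : ∀ (v : closureIYSMul M (A ∩ B)) (k : ℕ), ∃ a ∈ closureIYSMul M A,
      ∃ b ∈ closureIYSMul M B,
        ‖a‖ ≤ 4 * ‖v.1‖ ∧ ‖b‖ ≤ 4 * ‖v.1‖ ∧ ‖v.1 - (a + b)‖ < (1 / 2 : ℝ) ^ k :=
    fun v k => exists_approx_add hnorm hA hB v.2 (by positivity)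
  choose a ha b hb han hbn hlt using step
  let r : ℕ → closureIYSMul M (A ∩ B) := fun k =>
    Nat.rec (motive := fun _ => closureIYSMul M (A ∩ B)) ⟨w, hw⟩ (fun k v => ⟨v.1 - (a v k + b v k), sub_mem v.2 (add_mem
      (closureIYSMul_antitone Set.inter_subset_left (ha v k))
      (closureIYSMul_antitone Set.inter_subset_right (hb v k)))⟩) k
  have hr : ∀ k, (r (k + 1) : M) = (r k : M) - (a (r k) k + b (r k) k) := fun _ => rfl
  have hrn : Summable fun k => ‖(r k : M)‖ := by
    rw [← summable_nat_add_iff 1]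
    refine Summable.of_nonneg_of_le (fun _ => norm_nonneg _) (fun k => ?_)
      summable_geometric_two
    rw [hr]
    exact (hlt _ _).le
  have hsa : Summable fun k => a (r k) k :=
    Summable.of_norm_bounded (hrn.mul_left 4) fun k => han _ _
  have hsb : Summable fun k => b (r k) k :=
    Summable.of_norm_bounded (hrn.mul_left 4) fun k => hbn _ _
  have closed : ∀ Y : Set X, IsClosed (closureIYSMul M Y : Set M) := fun Y =>
    AddSubgroup.isClosed_topologicalClosure _
  refine ⟨∑' k, a (r k) k, ?_, ∑' k, b (r k) k, ?_, ?_⟩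
  · exact (closed A).mem_of_tendsto hsa.hasSum.tendsto_sum_nat
      (Filter.Eventually.of_forall fun N => sum_mem fun k _ => ha _ _)
  · exact (closed B).mem_of_tendsto hsb.hasSum.tendsto_sum_nat
      (Filter.Eventually.of_forall fun N => sum_mem fun k _ => hb _ _)
  · have partialSum : ∀ N, ∑ k ∈ Finset.range N, (a (r k) k + b (r k) k) = w - r N := by
      intro N
      induction N with
      | zero => simp [r]
      | succ N ih =>
        rw [Finset.sum_range_succ, ih, hr]
        abel
    have hr0 : Filter.Tendsto (fun N => w - (r N : M)) Filter.atTop (nhds (w - 0)) :=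
      tendsto_const_nhds.sub (tendsto_zero_iff_norm_tendsto_zero.2 hrn.tendsto_atTop_zero)
    have hlim := (hsa.hasSum.add hsb.hasSum).tendsto_sum_nat
    simp only [partialSum] at hlim
    simpa using tendsto_nhds_unique hlim hr0

theorem exists_glue_finset [CompleteSpace M]
    (hnorm : ∀ (f : C(X, ℂ)) (m : M), ‖f • m‖ ≤ ‖f‖ * ‖m‖) {ι : Type*} {Y : ι → Set X}
    (hcl : ∀ i, IsClosed (Y i)) {v : ι → M}
    (hcompat : ∀ i j, v i - v j ∈ closureIYSMul M (Y i ∩ Y j)) (s : Finset ι) :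
    ∃ m : M, ∀ i ∈ s, m - v i ∈ closureIYSMul M (Y i) := by
  classical
  induction s using Finset.induction_on with
  | empty => exact ⟨0, by simp⟩
  | insert j s _ ih =>
    obtain ⟨m, hm⟩ := ih
    have hmj : m - v j ∈ closureIYSMul M ((⋃ i ∈ s, Y i) ∩ Y j) := by
      simp only [Set.iUnion_inter]
      refine mem_closureIYSMul_biUnion hnorm s (fun i => Y i ∩ Y j) fun i hi => ?_
      rw [← sub_add_sub_cancel m (v i) (v j)]
      exact add_mem (closureIYSMul_antitone Set.inter_subset_left (hm i hi)) (hcompat i j)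
    obtain ⟨a, ha, b, hb, hab⟩ := exists_add_of_mem_closureIYSMul_inter hnorm
      (isClosed_biUnion_finset fun i _ => hcl i) (hcl j) hmj
    refine ⟨m - a, fun i hi => ?_⟩
    rcases Finset.mem_insert.1 hi with rfl | hi
    · rw [sub_right_comm, ← hab, add_sub_cancel_left]
      exact hb
    · rw [sub_right_comm]
      exact sub_mem (hm i hi)
        (closureIYSMul_antitone (Set.subset_biUnion_of_mem (u := Y) hi) ha)

end Gluing

/-- Gluing: given a finite closed cover `X = X_1 ∪ ⋯ ∪ X_n` of a compact
Hausdorff space, a unital Banach `C(X,ℂ)`-module `M`, and elements `m_i` with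
`m_i − m_j ∈ closure(I_{X_i ∩ X_j} • M)` for all `i, j`, there is `m ∈ M` with
`m − m_i ∈ closure(I_{X_i} • M)` for all `i`. -/
theorem stmt4 {X M : Type*} [TopologicalSpace X] [CompactSpace X] [T2Space X]
    [NormedAddCommGroup M] [CompleteSpace M] [Module C(X, ℂ) M]
    (hnorm : ∀ (f : C(X, ℂ)) (m : M), ‖f • m‖ ≤ ‖f‖ * ‖m‖)
    (n : ℕ) (hn : 0 < n) (Xi : Fin n → Set X)
    (hcl : ∀ i, IsClosed (Xi i)) (hcov : ⋃ i, Xi i = Set.univ)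
    (mv : Fin n → M)
    (hcompat : ∀ i j, mv i - mv j ∈
      closure ((IY (Xi i ∩ Xi j) • (⊤ : Submodule C(X, ℂ) M) : Submodule C(X, ℂ) M) : Set M)) :
    ∃ m : M, ∀ i, m - mv i ∈
      closure ((IY (Xi i) • (⊤ : Submodule C(X, ℂ) M) : Submodule C(X, ℂ) M) : Set M) := by
  obtain ⟨m, hm⟩ := exists_glue_finset hnorm hcl hcompat Finset.univ
  exact ⟨m, fun i => hm i (Finset.mem_univ i)⟩
end

section
/- Let X be a compact Hausdorff space and U ⊆ X an open subset. If the ideal C_0(U) := {f ∈ C(X,ℂ) : f(x) = 0 for all x ∈ X ∖ U} is finitely generated as a C(X,ℂ)-module, then U is clopen in X. -/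
/-- Every continuous complex-valued function is a product of two continuous functions whose zeros
include its own. -/
theorem exists_mul_eq_and_vanishing {X : Type*} [TopologicalSpace X] (f : C(X, ℂ)) :
    ∃ g h : C(X, ℂ), g * h = f ∧ ∀ x, f x = 0 → g x = 0 ∧ h x = 0 := by
  have hnorm : ∀ x, ‖f x / (√‖f x‖ : ℂ)‖ = √‖f x‖ := fun x => by
    rw [norm_div, Complex.norm_real, Real.norm_of_nonneg (Real.sqrt_nonneg _), Real.div_sqrt]
  have hsqrt : Continuous fun x => √‖f x‖ := by fun_prop
  refine ⟨⟨fun x => (√‖f x‖ : ℂ), by fun_prop⟩, ⟨fun x => f x / (√‖f x‖ : ℂ), ?_⟩, ?_, ?_⟩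
  · refine continuous_iff_continuousAt.2 fun x => ?_
    by_cases hx : f x = 0
    · have hlim := hsqrt.tendsto x
      simp only [hx, norm_zero, Real.sqrt_zero] at hlim
      rw [ContinuousAt, hx, zero_div]
      exact squeeze_zero_norm (fun y => (hnorm y).le) hlim
    · refine ContinuousAt.div (by fun_prop) (by fun_prop) ?_
      simpa [Real.sqrt_eq_zero] using hx
  · ext x
    by_cases hx : f x = 0
    · simp [hx]
    · have : (√‖f x‖ : ℂ) ≠ 0 := by simpa [Real.sqrt_eq_zero] using hx
      exact mul_div_cancel₀ (f x) this
  · intro x hx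
    simp [hx]

theorem isIdempotentElem_IY {X : Type*} [TopologicalSpace X] (Y : Set X) :
    IsIdempotentElem (IY Y) := by
  refine le_antisymm Ideal.mul_le_left fun f hf => ?_
  obtain ⟨g, h, rfl, hz⟩ := exists_mul_eq_and_vanishing f
  exact Ideal.mul_mem_mul (fun y hy => (hz y (hf y hy)).1) fun y hy => (hz y (hf y hy)).2

theorem IY_compl_eq_idealOfSet {X : Type*} [TopologicalSpace X] (U : Set X) :
    IY Uᶜ = ContinuousMap.idealOfSet ℂ U := by
  ext f
  rw [ContinuousMap.mem_idealOfSet]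
  exact ⟨fun h x hx => h x hx, fun h x hx => h hx⟩

/-- If `U` is an open subset of a compact Hausdorff space `X` and the ideal
`C_0(U) = I_{X ∖ U}` of functions vanishing off `U` is algebraically finitely
generated as a `C(X,ℂ)`-module, then `U` is clopen. -/
theorem stmt8 {X : Type*} [TopologicalSpace X] [CompactSpace X] [T2Space X]
    (U : Set X) (hU : IsOpen U)
    (hfg : (IY Uᶜ : Ideal C(X, ℂ)).FG) :
    IsClopen U := by
  obtain ⟨e, he, hIe⟩ := (Ideal.isIdempotentElem_iff_of_fg _ hfg).1 (isIdempotentElem_IY Uᶜ)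
  have he_mem : e ∈ IY Uᶜ := hIe ▸ Ideal.mem_span_singleton_self e
  have hU_eq : U = e ⁻¹' {1} := by
    ext x
    refine ⟨fun hx => ?_, fun hx => ?_⟩
    · rw [← ContinuousMap.setOfIdeal_ofSet_of_isOpen ℂ hU, ContinuousMap.mem_setOfIdeal,
        ← IY_compl_eq_idealOfSet, hIe] at hx
      obtain ⟨f, hf, hfx⟩ := hx
      obtain ⟨c, rfl⟩ := Ideal.mem_span_singleton'.1 hf
      exact mul_right_cancel₀ (right_ne_zero_of_mul hfx)
        ((DFunLike.congr_fun he x).trans (one_mul (e x)).symm)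
    · by_contra hxU
      exact zero_ne_one ((he_mem x hxU).symm.trans hx)
  exact ⟨hU_eq ▸ isClosed_singleton.preimage e.continuous, hU⟩
end

section
/- Let ω₁ be the first uncountable ordinal and X = [0, ω₁] the compact Hausdorff space of ordinals ≤ ω₁ with the order topology. Regard ℂ as a C(X,ℂ)-module via the evaluation ring homomorphism f ↦ f(ω₁). Then ℂ is a flat C(X,ℂ)-module, even though the singleton {ω₁} is not open in X. -/
/-- The first uncountable ordinal. -/
noncomputable def w1 : Ordinal := (Cardinal.aleph 1).ord

/-- The space `[0, ω₁]` of all ordinals `≤ ω₁`. -/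
def OmegaInterval : Type _ := {β : Ordinal // β ≤ w1}

noncomputable instance : LinearOrder OmegaInterval :=
  inferInstanceAs (LinearOrder {β : Ordinal // β ≤ w1})

/-- `[0, ω₁]` carries the order topology. -/
noncomputable instance : TopologicalSpace OmegaInterval := Preorder.topology OmegaInterval

instance : OrderTopology OmegaInterval := ⟨rfl⟩

/-- Evaluation at `ω₁` as a ring homomorphism `C([0,ω₁], ℂ) →+* ℂ`. -/
noncomputable def evAtTop : C(OmegaInterval, ℂ) →+* ℂ where
  toFun f := f ⟨w1, le_rfl⟩
  map_one' := rfl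
  map_mul' _ _ := rfl
  map_zero' := rfl
  map_add' _ _ := rfl

/-- The `C([0,ω₁],ℂ)`-module structure on `ℂ` by restriction of scalars along
evaluation at `ω₁`. -/
noncomputable def evModule : Module C(OmegaInterval, ℂ) ℂ := Module.compHom ℂ evAtTop

namespace OmegaInterval

/-- The top point `ω₁` of `[0, ω₁]`. -/
noncomputable def omegaOne : OmegaInterval := ⟨w1, le_rfl⟩

theorem le_omegaOne (a : OmegaInterval) : a ≤ omegaOne := a.2

theorem w1_eq_omega : w1 = Ordinal.omega 1 := Cardinal.ord_aleph 1

theorem succ_lt_w1 {a : Ordinal} (ha : a < w1) : Order.succ a < w1 :=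
  (Cardinal.isSuccLimit_ord (Cardinal.aleph0_le_aleph 1)).succ_lt ha

/-- The immediate successor in `[0, ω₁]` of a point below `ω₁`. -/
theorem exists_Ioi_eq_Ici {a : OmegaInterval} (ha : a < omegaOne) :
    ∃ b < omegaOne, a < b ∧ Set.Ioi a = Set.Ici b := by
  have h : a.1 < w1 := ha
  refine ⟨⟨Order.succ a.1, (succ_lt_w1 h).le⟩, succ_lt_w1 h, Order.lt_succ a.1, ?_⟩
  ext x
  exact (Order.succ_le_iff (a := a.1) (b := x.1)).symm

theorem isClopen_Ioi {a : OmegaInterval} (ha : a < omegaOne) : IsClopen (Set.Ioi a) := by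
  obtain ⟨b, -, -, hb⟩ := exists_Ioi_eq_Ici ha
  exact ⟨hb ▸ isClosed_Ici, isOpen_Ioi⟩

theorem exists_lt_omegaOne : ∃ a : OmegaInterval, a < omegaOne :=
  have h : (0 : Ordinal) < w1 := Cardinal.ord_pos.2 (Cardinal.aleph_pos 1)
  ⟨⟨0, h.le⟩, h⟩

theorem exists_Ioi_subset {s : Set OmegaInterval} (hs : s ∈ nhds omegaOne) :
    ∃ a < omegaOne, Set.Ioi a ⊆ s := by
  obtain ⟨a, ha, h⟩ := exists_Ioc_subset_of_mem_nhds hs exists_lt_omegaOne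
  exact ⟨a, ha, fun x hx => h ⟨hx, le_omegaOne x⟩⟩

theorem not_isOpen_singleton_omegaOne : ¬ IsOpen ({omegaOne} : Set OmegaInterval) := by
  intro h
  obtain ⟨a, ha, hs⟩ := exists_Ioi_subset (h.mem_nhds rfl)
  obtain ⟨b, hb, hab, -⟩ := exists_Ioi_eq_Ici ha
  exact hb.ne (hs hab)

/-- Countably many points below `ω₁` have a common upper bound below `ω₁`. -/
theorem exists_lt_omegaOne_forall_le (u : ℕ → OmegaInterval) (hu : ∀ n, u n < omegaOne) :
    ∃ a < omegaOne, ∀ n, u n ≤ a := by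
  have hu (n : ℕ) : (u n).1 < w1 := hu n
  have h : ⨆ n, (u n).1 < w1 :=
    (Ordinal.iSup_lt_omega_one fun n => (hu n).trans_eq w1_eq_omega).trans_eq w1_eq_omega.symm
  exact ⟨⟨_, h.le⟩, h, fun n => Ordinal.le_iSup (fun n => (u n).1) n⟩

/-- A continuous function on `[0, ω₁]` vanishing at `ω₁` vanishes on a neighbourhood of `ω₁`. -/
theorem exists_forall_gt_eq_zero (f : C(OmegaInterval, ℂ)) (hf : f omegaOne = 0) :
    ∃ a < omegaOne, ∀ x > a, f x = 0 := by
  have key (n : ℕ) : ∃ a < omegaOne, Set.Ioi a ⊆ {x | ‖f x‖ < 1 / ((n : ℝ) + 1)} := by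
    refine exists_Ioi_subset ((isOpen_lt (by fun_prop) continuous_const).mem_nhds ?_)
    simpa [hf] using Nat.cast_add_one_pos (α := ℝ) n
  choose u hu hsub using key
  obtain ⟨a, ha, hua⟩ := exists_lt_omegaOne_forall_le u hu
  refine ⟨a, ha, fun x hx => ?_⟩
  by_contra hne
  obtain ⟨n, hn⟩ := exists_nat_one_div_lt (norm_pos_iff.2 hne)
  exact lt_asymm hn (hsub n ((hua n).trans_lt hx))

/-- Every function vanishing at `ω₁` is annihilated by one that does not vanish there. -/
theorem exists_mul_eq_zero (f : C(OmegaInterval, ℂ)) (hf : f omegaOne = 0) :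
    ∃ g : C(OmegaInterval, ℂ), g omegaOne = 1 ∧ g * f = 0 := by
  obtain ⟨a, ha, h⟩ := exists_forall_gt_eq_zero f hf
  refine ⟨⟨(Set.Ioi a).indicator 1, (isClopen_Ioi ha).continuous_indicator continuous_one⟩,
    Set.indicator_of_mem (s := Set.Ioi a) ha 1, ?_⟩
  ext x
  by_cases hx : a < x
  · simp [h x hx]
  · simp [Set.indicator_of_notMem (s := Set.Ioi a) hx]

/-- Evaluation at `ω₁` is the localization at the functions not vanishing at `ω₁`. -/
theorem isLocalization_evAtTop :
    @IsLocalization _ _ ((nonZeroDivisors ℂ).comap evAtTop) ℂ _ evAtTop.toAlgebra := by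
  let := evAtTop.toAlgebra
  refine (isLocalization_iff _ _).2 ⟨fun f => (nonZeroDivisors.ne_zero f.2).isUnit, fun z => ?_, fun {f g} hfg => ?_⟩
  · refine ⟨(ContinuousMap.const _ z, 1), ?_⟩
    rw [Submonoid.coe_one, map_one, mul_one]
    rfl
  · have h : evAtTop f = evAtTop g := hfg
    obtain ⟨c, hc, hmul⟩ := exists_mul_eq_zero (f - g) (sub_eq_zero.2 h)
    refine ⟨⟨c, ?_⟩, sub_eq_zero.1 (by rw [← mul_sub]; exact hmul)⟩
    have hc : evAtTop c = 1 := hc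
    rw [Submonoid.mem_comap, hc]
    exact one_mem _

theorem flat_evModule : @Module.Flat C(OmegaInterval, ℂ) ℂ _ _ evModule :=
  letI := evAtTop.toAlgebra
  haveI := isLocalization_evAtTop
  IsLocalization.flat ℂ ((nonZeroDivisors ℂ).comap evAtTop)

end OmegaInterval

/-- `ℂ`, regarded as a `C([0,ω₁],ℂ)`-module via evaluation at `ω₁`, is flat,
even though the singleton `{ω₁}` is not open in `[0,ω₁]`. -/
theorem stmt12 :
    (@Module.Flat C(OmegaInterval, ℂ) ℂ _ _ evModule) ∧
    ¬ IsOpen ({⟨w1, le_rfl⟩} : Set OmegaInterval) :=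
  ⟨OmegaInterval.flat_evModule, OmegaInterval.not_isOpen_singleton_omegaOne⟩
end

section
/- Let X be a compact Hausdorff space with a finite closed cover X = X_1 ∪ ⋯ ∪ X_n, and let M be any C(X,ℂ)-module (purely algebraic, with no topology or norm on M). If I_{X_i} • M = M for every i = 1, …, n, then M = 0. -/
/-- If each of finitely many ideals `I i` satisfies `I i • M = M`, then so does their product. -/
theorem Submodule.finset_prod_smul_top_eq_top {R M ι : Type*} [CommRing R] [AddCommGroup M]
    [Module R M] (I : ι → Ideal R) (s : Finset ι)
    (h : ∀ i ∈ s, I i • (⊤ : Submodule R M) = ⊤) :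
    (∏ i ∈ s, I i) • (⊤ : Submodule R M) = ⊤ := by
  classical
  induction s using Finset.induction_on with
  | empty => simp
  | insert a s ha ih =>
    rw [Finset.prod_insert ha, Submodule.mul_smul,
      ih fun i hi => h i (Finset.mem_insert_of_mem hi), h a (Finset.mem_insert_self a s)]

/-- The product of the vanishing ideals of the members of a finite cover is zero. -/
theorem prod_IY_eq_bot_of_iUnion_eq_univ {X ι : Type*} [TopologicalSpace X] [Fintype ι]
    (Y : ι → Set X) (hY : ⋃ i, Y i = Set.univ) : ∏ i, IY (Y i) = ⊥ := by
  refine eq_bot_iff.2 fun f hf => ?_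
  have hf' : ∀ i, f ∈ IY (Y i) := fun i =>
    Finset.inf_le (f := fun i => IY (Y i)) (Finset.mem_univ i) (Ideal.prod_le_inf hf)
  refine (Submodule.mem_bot _).2 (ContinuousMap.ext fun x => ?_)
  obtain ⟨i, hi⟩ := Set.mem_iUnion.1 (hY ▸ Set.mem_univ x)
  exact hf' i x hi

/-- For a finite closed cover `X = X_1 ∪ ⋯ ∪ X_n` of a compact Hausdorff space
and any purely algebraic `C(X,ℂ)`-module `M`: if `I_{X_i} • M = M` for all `i`,
then `M = 0`. -/
theorem stmt13 {X M : Type*} [TopologicalSpace X] [CompactSpace X] [T2Space X]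
    [AddCommGroup M] [Module C(X, ℂ) M]
    (n : ℕ) (Xi : Fin n → Set X)
    (hcl : ∀ i, IsClosed (Xi i)) (hcov : ⋃ i, Xi i = Set.univ)
    (h : ∀ i, IY (Xi i) • (⊤ : Submodule C(X, ℂ) M) = ⊤) :
    ∀ m : M, m = 0 := by
  intro m
  have htop := Submodule.finset_prod_smul_top_eq_top (fun i => IY (Xi i)) Finset.univ
    fun i _ => h i
  rw [prod_IY_eq_bot_of_iUnion_eq_univ Xi hcov, Submodule.bot_smul] at htop
  exact (Submodule.mem_bot C(X, ℂ)).1 (htop ▸ Submodule.mem_top)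
end

section
/- There exist a unital C([-1,1],ℂ)-module M (purely algebraic, with no topology on M) and a nonzero element m ∈ M such that m ∈ I_{[-1,0]} • M and m ∈ I_{[0,1]} • M. Consequently, for plain algebraic modules over C([-1,1],ℂ) the canonical map M → M/(I_{[-1,0]} • M) × M/(I_{[0,1]} • M) associated to the closed cover [-1,1] = [-1,0] ∪ [0,1] can fail to be injective. -/
/-- The closed left half `[-1,0]` of the interval `[-1,1]`, as a subset of the
subtype `[-1,1]`. -/
def leftHalf : Set (Set.Icc (-1 : ℝ) 1) := {x | (x : ℝ) ≤ 0}

/-- The closed right half `[0,1]` of the interval `[-1,1]`. -/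
def rightHalf : Set (Set.Icc (-1 : ℝ) 1) := {x | 0 ≤ (x : ℝ)}

/-- The positive part `x ↦ max x 0` on `[-1,1]`, as a complex-valued continuous function. -/
noncomputable def posPartFun : C((Set.Icc (-1 : ℝ) 1 : Set ℝ), ℂ) where
  toFun x := ((max (x : ℝ) 0 : ℝ) : ℂ)
  continuous_toFun := by fun_prop

/-- The negative part `x ↦ max (-x) 0` on `[-1,1]`, as a complex-valued continuous function. -/
noncomputable def negPartFun : C((Set.Icc (-1 : ℝ) 1 : Set ℝ), ℂ) where
  toFun x := ((max (-(x : ℝ)) 0 : ℝ) : ℂ)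
  continuous_toFun := by fun_prop

theorem posPartFun_mem_IY_leftHalf : posPartFun ∈ IY leftHalf := fun y hy => by
  simpa [posPartFun, leftHalf] using hy

theorem negPartFun_mem_IY_rightHalf : negPartFun ∈ IY rightHalf := fun y hy => by
  simpa [negPartFun, rightHalf] using hy

/-- No continuous function is `1` where `x > 0` and `0` where `x < 0`. -/
theorem false_of_mul_posPartFun_of_mul_negPartFun (a : C((Set.Icc (-1 : ℝ) 1 : Set ℝ), ℂ))
    (hpos : a * posPartFun = posPartFun) (hneg : a * negPartFun = 0) : False := by
  have h11 : (-1 : ℝ) ≤ 1 := by norm_num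
  set b : ℝ → ℂ := fun t => a (Set.projIcc (-1) 1 h11 t) with hb
  have hbc : Continuous b := a.continuous.comp continuous_projIcc
  have hlim : Filter.Tendsto (fun n : ℕ => 1 / ((n : ℝ) + 1)) Filter.atTop (nhds 0) :=
    tendsto_one_div_add_atTop_nhds_zero_nat
  have hlim' : Filter.Tendsto (fun n : ℕ => -(1 / ((n : ℝ) + 1))) Filter.atTop (nhds 0) := by
    simpa using hlim.neg
  have hmem (n : ℕ) : 0 < 1 / ((n : ℝ) + 1) ∧ 1 / ((n : ℝ) + 1) ≤ 1 := by
    refine ⟨by positivity, ?_⟩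
    rw [div_le_one (by positivity)]
    linarith [(Nat.cast_nonneg n : (0 : ℝ) ≤ n)]
  have hone : ∀ t : ℝ, 0 < t ∧ t ≤ 1 → b t = 1 := by
    rintro t ⟨h0, h1⟩
    have ht : t ∈ Set.Icc (-1 : ℝ) 1 := ⟨by linarith, h1⟩
    have h := DFunLike.congr_fun hpos ⟨t, ht⟩
    have hne : (t : ℂ) ≠ 0 := by exact_mod_cast h0.ne'
    simp only [ContinuousMap.mul_apply, posPartFun, ContinuousMap.coe_mk, max_eq_left h0.le] at h
    simpa only [hb, Set.projIcc_of_mem h11 ht] using (mul_eq_right₀ hne).1 h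
  have hzero : ∀ t : ℝ, 0 < t ∧ t ≤ 1 → b (-t) = 0 := by
    rintro t ⟨h0, h1⟩
    have ht : -t ∈ Set.Icc (-1 : ℝ) 1 := ⟨by linarith, by linarith⟩
    have h := DFunLike.congr_fun hneg ⟨-t, ht⟩
    have hne : (t : ℂ) ≠ 0 := by exact_mod_cast h0.ne'
    simp only [ContinuousMap.mul_apply, negPartFun, ContinuousMap.coe_mk, neg_neg,
      max_eq_left h0.le, ContinuousMap.zero_apply] at h
    simpa only [hb, Set.projIcc_of_mem h11 ht] using (mul_eq_zero.1 h).resolve_right hne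
  have h1 : b 0 = 1 := tendsto_nhds_unique ((hbc.tendsto 0).comp hlim)
    (tendsto_const_nhds.congr fun n => (hone _ (hmem n)).symm)
  have h0 : b 0 = 0 := tendsto_nhds_unique ((hbc.tendsto 0).comp hlim')
    (tendsto_const_nhds.congr fun n => (hzero _ (hmem n)).symm)
  exact one_ne_zero (h1.symm.trans h0)

/-- There exist a purely algebraic unital `C([-1,1],ℂ)`-module `M` and a nonzero
`m ∈ M` with `m ∈ I_{[-1,0]} • M` and `m ∈ I_{[0,1]} • M`; consequently the
canonical map `M → M/(I_{[-1,0]} • M) × M/(I_{[0,1]} • M)` associated to the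
closed cover `[-1,1] = [-1,0] ∪ [0,1]` fails to be injective. -/
theorem stmt15 :
    ∃ (M : ModuleCat.{0} C((Set.Icc (-1 : ℝ) 1 : Set ℝ), ℂ)) (m : M),
      m ≠ 0 ∧
      m ∈ IY leftHalf • (⊤ : Submodule C((Set.Icc (-1 : ℝ) 1 : Set ℝ), ℂ) M) ∧
      m ∈ IY rightHalf • (⊤ : Submodule C((Set.Icc (-1 : ℝ) 1 : Set ℝ), ℂ) M) ∧
      ¬ Function.Injective (fun y : M =>
        ((Submodule.Quotient.mk y :
            M ⧸ (IY leftHalf • (⊤ : Submodule C((Set.Icc (-1 : ℝ) 1 : Set ℝ), ℂ) M))),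
         (Submodule.Quotient.mk y :
            M ⧸ (IY rightHalf • (⊤ : Submodule C((Set.Icc (-1 : ℝ) 1 : Set ℝ), ℂ) M))))) := by
  let N : Submodule C((Set.Icc (-1 : ℝ) 1 : Set ℝ), ℂ)
      (C((Set.Icc (-1 : ℝ) 1 : Set ℝ), ℂ) × C((Set.Icc (-1 : ℝ) 1 : Set ℝ), ℂ)) :=
    Submodule.span _ {(posPartFun, -negPartFun)}
  let m : ModuleCat.of C((Set.Icc (-1 : ℝ) 1 : Set ℝ), ℂ) (_ ⧸ N) := N.mkQ (posPartFun, 0)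
  have hm : m ≠ 0 := by
    intro h
    obtain ⟨a, ha⟩ := Submodule.mem_span_singleton.1 ((Submodule.Quotient.mk_eq_zero N).1 h)
    have ha' := Prod.ext_iff.1 ha
    exact false_of_mul_posPartFun_of_mul_negPartFun a ha'.1
      (neg_eq_zero.1 ((mul_neg a negPartFun).symm.trans ha'.2))
  have hl : m ∈ IY leftHalf • (⊤ : Submodule C((Set.Icc (-1 : ℝ) 1 : Set ℝ), ℂ)
      (ModuleCat.of C((Set.Icc (-1 : ℝ) 1 : Set ℝ), ℂ) (_ ⧸ N))) := by
    have h : m = posPartFun • N.mkQ (1, 0) := by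
      rw [← map_smul]
      simp [m]
    rw [h]
    exact Submodule.smul_mem_smul posPartFun_mem_IY_leftHalf Submodule.mem_top
  have hr : m ∈ IY rightHalf • (⊤ : Submodule C((Set.Icc (-1 : ℝ) 1 : Set ℝ), ℂ)
      (ModuleCat.of C((Set.Icc (-1 : ℝ) 1 : Set ℝ), ℂ) (_ ⧸ N))) := by
    have h : m = negPartFun • N.mkQ (0, 1) := by
      rw [← map_smul]
      refine (Submodule.Quotient.eq N).2 (Submodule.mem_span_singleton.2 ⟨1, ?_⟩)
      simp
    rw [h]
    exact Submodule.smul_mem_smul negPartFun_mem_IY_rightHalf Submodule.mem_top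
  refine ⟨_, m, hm, hl, hr, fun hinj => hm (hinj (Prod.ext ?_ ?_))⟩
  · exact (Submodule.Quotient.eq _).2 (by simpa using hl)
  · exact (Submodule.Quotient.eq _).2 (by simpa using hr)
end
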